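/- arXiv:1601.06890 — 2 statements merged into one kernel-verified Lean document; each statement's English description precedes it below -/
import Mathlib

section
/- Let G be a balanced bipartite graph on 2n vertices with δ(G) ≥ k, where k ≥ 2 and n ≥ (k+2)². If ρ(G) ≥ ρ(Q_n^k), then G is traceable unless G = Q_n^k. -/
open SimpleGraph

attribute [local instance] Classical.propDecidable

/-- The (adjacency) spectral radius of a graph, as the largest adjacency eigenvalue. -/
noncomputable def specRad {V : Type*} [Fintype V] [DecidableEq V] (G : SimpleGraph V) : ℝ :=
  sSup (spectrum ℝ (G.adjMatrix ℝ))

/-- The signless Laplacian matrix `Q = D + A` of a graph. -/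
noncomputable def signlessLaplacian {V : Type*} [Fintype V] [DecidableEq V]
    (G : SimpleGraph V) : Matrix V V ℝ :=
  Matrix.diagonal (fun v => (G.degree v : ℝ)) + G.adjMatrix ℝ

/-- The signless Laplacian spectral radius of a graph. -/
noncomputable def qSpec {V : Type*} [Fintype V] [DecidableEq V] (G : SimpleGraph V) : ℝ :=
  sSup (spectrum ℝ (signlessLaplacian G))

/-- A graph is traceable if it has a Hamilton path. -/
def SimpleGraph.IsTraceable {V : Type*} (G : SimpleGraph V) : Prop :=
  ∃ (u v : V) (p : G.Walk u v), p.IsHamiltonian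

/-- A graph on `Fin m ⊕ Fin n` is bipartite with bipartition `{Fin m, Fin n}`:
all edges go between the two parts. -/
def CrossOnly {m n : ℕ} (G : SimpleGraph (Fin m ⊕ Fin n)) : Prop :=
  (∀ x y : Fin m, ¬ G.Adj (Sum.inl x) (Sum.inl y)) ∧
  (∀ x y : Fin n, ¬ G.Adj (Sum.inr x) (Sum.inr y))

/-- The graph `Q_n^k = K_{k,n-k-1} ⊔ Φ_{n-k,k+1}`: a vertex `inl x` with `x < k` is joined to
all of the right side, a vertex `inr y` with `y < n-k-1` is joined to all of the left side,
and there are no other edges. -/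
def Qgraph (n k : ℕ) : SimpleGraph (Fin n ⊕ Fin n) :=
  SimpleGraph.fromRel (fun a b =>
    match a, b with
    | Sum.inl x, Sum.inr y => x.val < k ∨ y.val < n - k - 1
    | _, _ => False)

/-- The graph `R_n^k = K_{k,k} ∪ K_{n-k,n-k}` (disjoint union). -/
def Rgraph (n k : ℕ) : SimpleGraph (Fin n ⊕ Fin n) :=
  SimpleGraph.fromRel (fun a b =>
    match a, b with
    | Sum.inl x, Sum.inr y => (x.val < k ∧ y.val < k) ∨ (k ≤ x.val ∧ k ≤ y.val)
    | _, _ => False)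

/-- The graph `S_n^k = K_{k,n-k-1} ⊔ Φ_{n-k,k}` on parts of sizes `n` and `n-1`. -/
def Sgraph (n k : ℕ) : SimpleGraph (Fin n ⊕ Fin (n - 1)) :=
  SimpleGraph.fromRel (fun a b =>
    match a, b with
    | Sum.inl x, Sum.inr y => x.val < k ∨ y.val < n - k - 1
    | _, _ => False)

/-- The quasi-complement of a bipartite graph: `inl x` and `inr y` are adjacent iff they are
nonadjacent in `G`; no edges inside the parts. -/
def quasiComplement {m n : ℕ} (G : SimpleGraph (Fin m ⊕ Fin n)) : SimpleGraph (Fin m ⊕ Fin n) :=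
  SimpleGraph.fromRel (fun a b =>
    match a, b with
    | Sum.inl x, Sum.inr y => ¬ G.Adj (Sum.inl x) (Sum.inr y)
    | _, _ => False)

/-- `G` is isomorphic to a subgraph of `H`. -/
def IsoSubgraph {V W : Type*} (G : SimpleGraph V) (H : SimpleGraph W) : Prop :=
  ∃ H' : SimpleGraph W, H' ≤ H ∧ Nonempty (G ≃g H')


namespace BipTrace

/-- degree of a left vertex -/
noncomputable def dX {n : ℕ} (E : Fin n → Fin n → Prop) (x : Fin n) : ℕ :=
  (Finset.univ.filter (fun y => E x y)).card

/-- degree of a right vertex -/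
noncomputable def dY {n : ℕ} (E : Fin n → Fin n → Prop) (y : Fin n) : ℕ :=
  (Finset.univ.filter (fun x => E x y)).card

/-- the relation with one more pair -/
def addE {n : ℕ} (E : Fin n → Fin n → Prop) (x y : Fin n) : Fin n → Fin n → Prop :=
  fun a b => E a b ∨ (a = x ∧ b = y)

/-- the alternating sequence `f 0, g 0, f 1, g 1, …` is a Hamilton path -/
def PathOf {n : ℕ} (E : Fin n → Fin n → Prop) (f g : ℕ → Fin n) : Prop :=
  (∀ i j, i < n → j < n → f i = f j → i = j) ∧ (∀ i j, i < n → j < n → g i = g j → i = j) ∧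
  (∀ i, i < n → E (f i) (g i)) ∧ (∀ i, i + 1 < n → E (f (i + 1)) (g i))

def HP {n : ℕ} (E : Fin n → Fin n → Prop) : Prop := ∃ f g, PathOf E f g

def HC {n : ℕ} (E : Fin n → Fin n → Prop) : Prop :=
  ∃ f g, PathOf E f g ∧ E (f 0) (g (n - 1))

lemma surj_of {n : ℕ} {f : ℕ → Fin n} (h : ∀ i j, i < n → j < n → f i = f j → i = j) (y : Fin n) :
    ∃ i, i < n ∧ f i = y := by
  have hi : Function.Injective (fun i : Fin n => f i.val) := by
    intro a b hab
    exact Fin.ext (h _ _ a.2 b.2 hab)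
  obtain ⟨a, ha⟩ := (Finite.injective_iff_surjective.1 hi) y
  exact ⟨a.1, a.2, ha⟩

lemma cross {n : ℕ} {E : Fin n → Fin n → Prop} {f g : ℕ → Fin n} (h : PathOf E f g)
    (i : ℕ) (hi : i < n) (h1 : E (f 0) (g i)) (h2 : E (f i) (g (n - 1))) : HC E := by
  obtain ⟨hf, hg, e1, e2⟩ := h
  refine ⟨fun j => if j ≤ i then f j else f (n + i - j),
    fun j => if j < i then g j else g (n - 1 + i - j), ⟨?_, ?_, ?_, ?_⟩, ?_⟩
  · intro a b ha hb hab
    dsimp only at hab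
    split_ifs at hab <;> have := hf _ _ (by omega) (by omega) hab <;> omega
  · intro a b ha hb hab
    dsimp only at hab
    split_ifs at hab <;> have := hg _ _ (by omega) (by omega) hab <;> omega
  · intro j hj
    dsimp only
    split_ifs with c1 c2 c2
    · exact e1 j hj
    · have : j = i := by omega
      subst this
      have : n - 1 + j - j = n - 1 := by omega
      rw [this]; exact h2
    · omega
    · have := e2 (n - 1 + i - j) (by omega)
      have e : n - 1 + i - j + 1 = n + i - j := by omega
      rw [e] at this; exact this
  · intro j hj
    dsimp only
    split_ifs with c1 c2 c2
    · exact e2 j hj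
    · omega
    · omega
    · have := e1 (n - 1 + i - j) (by omega)
      have e : n + i - (j + 1) = n - 1 + i - j := by omega
      rw [e]; exact this
  · dsimp only
    rw [if_pos (Nat.zero_le _), if_neg (by omega)]
    have : n - 1 + i - (n - 1) = i := by omega
    rw [this]; exact h1

lemma path_deg {n : ℕ} {E : Fin n → Fin n → Prop} {f g : ℕ → Fin n} (h : PathOf E f g)
    (hc : ¬ HC E) : dX E (f 0) + dY E (g (n - 1)) ≤ n := by
  have s1 : dX E (f 0) ≤ ((Finset.range n).filter (fun i => E (f 0) (g i))).card := by
    refine le_trans (Finset.card_le_card ?_) (Finset.card_image_le (f := g))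
    intro y hy
    obtain ⟨i, hi, rfl⟩ := surj_of h.2.1 y
    simp only [Finset.mem_filter, Finset.mem_univ, true_and] at hy
    simp only [Finset.mem_image, Finset.mem_filter, Finset.mem_range]
    exact ⟨i, ⟨hi, hy⟩, rfl⟩
  have s2 : dY E (g (n - 1)) ≤ ((Finset.range n).filter (fun i => E (f i) (g (n - 1)))).card := by
    refine le_trans (Finset.card_le_card ?_) (Finset.card_image_le (f := f))
    intro y hy
    obtain ⟨i, hi, rfl⟩ := surj_of h.1 y
    simp only [Finset.mem_filter, Finset.mem_univ, true_and] at hy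
    simp only [Finset.mem_image, Finset.mem_filter, Finset.mem_range]
    exact ⟨i, ⟨hi, hy⟩, rfl⟩
  have hd : Disjoint ((Finset.range n).filter (fun i => E (f 0) (g i)))
      ((Finset.range n).filter (fun i => E (f i) (g (n - 1)))) := by
    rw [Finset.disjoint_left]
    intro i hi hj
    simp only [Finset.mem_filter, Finset.mem_range] at hi hj
    exact hc (cross h i hi.1 hi.2 hj.2)
  have := Finset.card_union_of_disjoint hd
  have h3 : (((Finset.range n).filter (fun i => E (f 0) (g i))) ∪
      ((Finset.range n).filter (fun i => E (f i) (g (n - 1))))).card ≤ n := by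
    refine le_trans (Finset.card_le_card (Finset.union_subset (Finset.filter_subset _ _)
      (Finset.filter_subset _ _))) (by simp)
  omega

/-- rotate a cycle so that it starts at `x` -/
lemma rot {n : ℕ} {E : Fin n → Fin n → Prop} (h : HC E) (x : Fin n) :
    ∃ f g, PathOf E f g ∧ E (f 0) (g (n - 1)) ∧ f 0 = x := by
  obtain ⟨f, g, ⟨hf, hg, e1, e2⟩, hw⟩ := h
  obtain ⟨i, hi, rfl⟩ := surj_of hf x
  refine ⟨fun j => if i + j < n then f (i + j) else f (i + j - n),
    fun j => if i + j < n then g (i + j) else g (i + j - n), ⟨?_, ?_, ?_, ?_⟩, ?_, ?_⟩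
  · intro a b ha hb hab
    dsimp only at hab
    split_ifs at hab <;> have := hf _ _ (by omega) (by omega) hab <;> omega
  · intro a b ha hb hab
    dsimp only at hab
    split_ifs at hab <;> have := hg _ _ (by omega) (by omega) hab <;> omega
  · intro j hj
    dsimp only
    split_ifs
    · exact e1 _ (by omega)
    · exact e1 _ (by omega)
  · intro j hj
    dsimp only
    split_ifs with c1 c2 c2
    · exact e2 _ (by omega)
    · omega
    · have a1 : i + (j + 1) - n = 0 := by omega
      have a2 : i + j = n - 1 := by omega
      rw [a1, a2]; exact hw
    · have := e2 (i + j - n) (by omega)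
      have e : i + j - n + 1 = i + (j + 1) - n := by omega
      rw [e] at this; exact this
  · dsimp only
    rw [if_pos (by omega)]
    split_ifs with c1
    · have : i = 0 := by omega
      subst this; simpa using hw
    · have := e2 (i - 1) (by omega)
      have e : i - 1 + 1 = i := by omega
      rw [e] at this
      have e' : i + (n - 1) - n = i - 1 := by omega
      rw [e']; exact this
  · dsimp only
    rw [if_pos (by omega)]; rfl

/-- reverse a cycle, keeping the starting point -/
lemma rev {n : ℕ} {E : Fin n → Fin n → Prop} {f g : ℕ → Fin n} (h : PathOf E f g) (h0 : 0 < n)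
    (hw : E (f 0) (g (n - 1))) :
    ∃ f' g', PathOf E f' g' ∧ E (f' 0) (g' (n - 1)) ∧ f' 0 = f 0 ∧ g' (n - 1) = g 0 := by
  obtain ⟨hf, hg, e1, e2⟩ := h
  refine ⟨fun j => if j = 0 then f 0 else f (n - j), fun j => g (n - 1 - j),
    ⟨?_, ?_, ?_, ?_⟩, ?_, ?_, ?_⟩
  · intro a b ha hb hab
    dsimp only at hab
    split_ifs at hab <;> first | omega | (have := hf _ _ (by omega) (by omega) hab; omega)
  · intro a b ha hb hab
    have := hg _ _ (by omega) (by omega) hab; omega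
  · intro j hj
    dsimp only
    split_ifs with c1
    · subst c1; simpa using hw
    · have := e2 (n - 1 - j) (by omega)
      have e : n - 1 - j + 1 = n - j := by omega
      rw [e] at this; exact this
  · intro j hj
    dsimp only
    rw [if_neg (by omega)]
    have := e1 (n - 1 - j) (by omega)
    have e : n - (j + 1) = n - 1 - j := by omega
    rw [e]; exact this
  · simpa using e1 0 h0
  · simp
  · simp

/-- a cycle through at most one new edge: either it is already there or we get a path. -/
lemma HC_add {n : ℕ} {E : Fin n → Fin n → Prop} (hn : 2 ≤ n) {x y : Fin n}
    (h : HC (addE E x y)) : HC E ∨ ∃ f g, PathOf E f g ∧ f 0 = x ∧ g (n - 1) = y := by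
  have key : ∀ f g, PathOf (addE E x y) f g → f 0 = x → g (n - 1) = y → PathOf E f g := by
    rintro f g ⟨hf, hg, e1, e2⟩ hx hy
    refine ⟨hf, hg, ?_, ?_⟩
    · intro i hi
      rcases e1 i hi with h | ⟨h1, h2⟩
      · exact h
      · have a1 := hf i 0 hi (by omega) (h1.trans hx.symm)
        have a2 := hg i (n - 1) hi (by omega) (h2.trans hy.symm)
        omega
    · intro i hi
      rcases e2 i hi with h | ⟨h1, h2⟩
      · exact h
      · have a1 := hf (i + 1) 0 hi (by omega) (h1.trans hx.symm)
        omega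
  obtain ⟨f, g, hp, hw, hx⟩ := rot h x
  by_cases hy : g (n - 1) = y
  · exact Or.inr ⟨f, g, key f g hp hx hy, hx, hy⟩
  by_cases hy0 : g 0 = y
  · obtain ⟨f', g', hp', _, h1, h2⟩ := rev hp (by omega) hw
    exact Or.inr ⟨f', g', key f' g' hp' (h1.trans hx) (h2.trans hy0), h1.trans hx, h2.trans hy0⟩
  left
  obtain ⟨hf, hg, e1, e2⟩ := hp
  refine ⟨f, g, ⟨hf, hg, ?_, ?_⟩, ?_⟩
  · intro i hi
    rcases e1 i hi with h | ⟨h1, h2⟩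
    · exact h
    · have a1 := hf i 0 hi (by omega) (h1.trans hx.symm)
      subst a1
      exact absurd h2 hy0
  · intro i hi
    rcases e2 i hi with h | ⟨h1, h2⟩
    · exact h
    · have a1 := hf (i + 1) 0 hi (by omega) (h1.trans hx.symm)
      omega
  · rcases hw with h | ⟨h1, h2⟩
    · exact h
    · exact absurd h2 hy

lemma HC_closure {n : ℕ} {E : Fin n → Fin n → Prop} (hn : 2 ≤ n) {x y : Fin n}
    (h : HC (addE E x y)) (hc : ¬ HC E) : dX E x + dY E y ≤ n := by
  rcases HC_add hn h with h | ⟨f, g, hp, rfl, rfl⟩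
  · exact absurd h hc
  · exact path_deg hp hc

lemma HC.hp {n : ℕ} {E : Fin n → Fin n → Prop} (h : HC E) : HP E := by
  obtain ⟨f, g, h, _⟩ := h
  exact ⟨f, g, h⟩

lemma HP_of_HC_add {n : ℕ} {E : Fin n → Fin n → Prop} (hn : 2 ≤ n) {x y : Fin n}
    (h : HC (addE E x y)) : HP E := by
  rcases HC_add hn h with h | ⟨f, g, hp, rfl, rfl⟩
  · exact h.hp
  · exact ⟨f, g, hp⟩

lemma dX_mono {n : ℕ} {E F : Fin n → Fin n → Prop} (h : E ≤ F) (x : Fin n) : dX E x ≤ dX F x := by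
  refine Finset.card_le_card ?_
  intro y hy
  simp only [Finset.mem_filter, Finset.mem_univ, true_and] at hy ⊢
  exact h _ _ hy

lemma dY_mono {n : ℕ} {E F : Fin n → Fin n → Prop} (h : E ≤ F) (x : Fin n) : dY E x ≤ dY F x := by
  refine Finset.card_le_card ?_
  intro y hy
  simp only [Finset.mem_filter, Finset.mem_univ, true_and] at hy ⊢
  exact h _ _ hy

lemma le_addE {n : ℕ} (E : Fin n → Fin n → Prop) (x y : Fin n) : E ≤ addE E x y :=
  fun _ _ h => Or.inl h

lemma PathOf.mono {n : ℕ} {E F : Fin n → Fin n → Prop} (h : E ≤ F) {f g : ℕ → Fin n}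
    (hp : PathOf E f g) : PathOf F f g :=
  ⟨hp.1, hp.2.1, fun i hi => h _ _ (hp.2.2.1 i hi), fun i hi => h _ _ (hp.2.2.2 i hi)⟩

lemma HP_closure {n : ℕ} {E : Fin n → Fin n → Prop} (hn : 2 ≤ n) {x y : Fin n}
    (h : HP (addE E x y)) (hc : ¬ HP E) : dX E x + dY E y ≤ n := by
  obtain ⟨f, g, hp⟩ := h
  have hno : ¬ HC (addE E (f 0) (g (n - 1))) := fun h => hc (HP_of_HC_add hn h)
  have h2 : HC (addE (addE E (f 0) (g (n - 1))) x y) := by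
    refine ⟨f, g, hp.mono ?_, Or.inl (Or.inr ⟨rfl, rfl⟩)⟩
    intro a b hab
    rcases hab with h | h
    · exact Or.inl (Or.inl h)
    · exact Or.inr h
  have := HC_closure hn h2 hno
  have h3 := dX_mono (le_addE E (f 0) (g (n - 1))) x
  have h4 := dY_mono (le_addE E (f 0) (g (n - 1))) y
  omega

lemma HP_flip {n : ℕ} {E : Fin n → Fin n → Prop} (h : HP E) : HP (fun a b => E b a) := by
  obtain ⟨f, g, hf, hg, e1, e2⟩ := h
  refine ⟨fun j => g (n - 1 - j), fun j => f (n - 1 - j), ?_, ?_, ?_, ?_⟩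
  · intro a b ha hb hab
    have := hg _ _ (by omega) (by omega) hab; omega
  · intro a b ha hb hab
    have := hf _ _ (by omega) (by omega) hab; omega
  · intro j hj
    exact e1 _ (by omega)
  · intro j hj
    have := e2 (n - 1 - (j + 1)) (by omega)
    have e : n - 1 - (j + 1) + 1 = n - 1 - j := by omega
    rw [e] at this; exact this

lemma HC_complete {n : ℕ} (h0 : 0 < n) {E : Fin n → Fin n → Prop} (h : ∀ x y, E x y) : HC E := by
  have hi : ∀ i j, i < n → j < n → (⟨i % n, Nat.mod_lt _ h0⟩ : Fin n) = ⟨j % n, Nat.mod_lt _ h0⟩ →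
      i = j := by
    intro i j hi hj hij
    rw [Fin.mk.injEq, Nat.mod_eq_of_lt hi, Nat.mod_eq_of_lt hj] at hij
    exact hij
  exact ⟨fun i => ⟨i % n, Nat.mod_lt _ h0⟩, fun i => ⟨i % n, Nat.mod_lt _ h0⟩,
    ⟨hi, hi, fun _ _ => h _ _, fun _ _ => h _ _⟩, h _ _⟩

lemma exists_max {n : ℕ} (P : (Fin n → Fin n → Prop) → Prop) (E : Fin n → Fin n → Prop)
    (h : ¬ P E) : ∃ F, E ≤ F ∧ ¬ P F ∧ ∀ x y, ¬ F x y → P (addE F x y) := by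
  obtain ⟨F, hEF, hF⟩ := Set.Finite.exists_le_maximal (Set.toFinite {F | ¬ P F}) h
  refine ⟨F, hEF, hF.prop, ?_⟩
  intro x y hxy
  by_contra hcon
  have := hF.le_of_ge (y := addE F x y) hcon (le_addE F x y)
  exact hxy (this x y (Or.inr ⟨rfl, rfl⟩))


/-- the number of non-neighbours of a left vertex -/
noncomputable def cX {n : ℕ} (E : Fin n → Fin n → Prop) (x : Fin n) : ℕ :=
  (Finset.univ.filter (fun y => ¬ E x y)).card

noncomputable def cY {n : ℕ} (E : Fin n → Fin n → Prop) (y : Fin n) : ℕ :=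
  (Finset.univ.filter (fun x => ¬ E x y)).card

lemma dX_add_cX {n : ℕ} (E : Fin n → Fin n → Prop) (x : Fin n) : dX E x + cX E x = n := by
  have := Finset.card_filter_add_card_filter_not (s := (Finset.univ : Finset (Fin n)))
    (fun y => E x y)
  simpa [dX, cX] using this

lemma dY_add_cY {n : ℕ} (E : Fin n → Fin n → Prop) (y : Fin n) : dY E y + cY E y = n :=
  dX_add_cX (fun a b => E b a) y

lemma sum_c {n : ℕ} (E : Fin n → Fin n → Prop) : ∑ x, cX E x = ∑ y, cY E y :=
  Finset.sum_card_bipartiteAbove_eq_sum_card_bipartiteBelow (fun x y => ¬ E x y)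

structure Cond (n k : ℕ) (E : Fin n → Fin n → Prop) : Prop where
  nonadj : ∀ x y, ¬ E x y → dX E x + dY E y ≤ n
  kx : ∀ x, k ≤ dX E x
  ky : ∀ y, k ≤ dY E y
  few : ∑ x, cX E x < n * (k + 1)
  hk : 2 ≤ k
  hn : (k + 2) ^ 2 ≤ n

lemma Cond.flip {n k : ℕ} {E : Fin n → Fin n → Prop} (h : Cond n k E) :
    Cond n k (fun a b => E b a) where
  nonadj x y hxy := by
    have := h.nonadj y x hxy
    change dY E x + dX E y ≤ n
    omega
  kx := h.ky
  ky := h.kx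
  few := by
    have := h.few
    rw [sum_c] at this
    exact this
  hk := h.hk
  hn := h.hn

lemma Cond.dich {n k : ℕ} {E : Fin n → Fin n → Prop} (h : Cond n k E) (y : Fin n) :
    dY E y ≤ k + 1 ∨ n ≤ dY E y + (k + 1) := by
  by_contra hcon
  push Not at hcon
  obtain ⟨h1, h2⟩ := hcon
  have a1 : cY E y * dY E y ≤ ∑ x, cX E x := by
    calc cY E y * dY E y = ∑ x ∈ Finset.univ.filter (fun x => ¬ E x y), dY E y := by
          rw [Finset.sum_const, smul_eq_mul, cY]
      _ ≤ ∑ x ∈ Finset.univ.filter (fun x => ¬ E x y), cX E x := by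
          refine Finset.sum_le_sum ?_
          intro x hx
          have := h.nonadj x y (by simpa using hx)
          have := dX_add_cX E x
          omega
      _ ≤ _ := Finset.sum_le_sum_of_subset (Finset.subset_univ _)
  have a2 := dY_add_cY E y
  have a3 := h.few
  have hn := h.hn
  obtain ⟨s, hs⟩ := Nat.exists_eq_add_of_le (show k + 2 ≤ dY E y by omega)
  obtain ⟨t, ht⟩ := Nat.exists_eq_add_of_le (show k + 2 ≤ cY E y by omega)
  rw [hs, ht] at a1
  have : n = 2 * (k + 2) + s + t := by omega
  have a5 := lt_of_le_of_lt a1 a3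
  rw [this] at a5 hn
  nlinarith [Nat.zero_le (s * t)]

/-- right vertices of small degree -/
noncomputable def Ys {n : ℕ} (k : ℕ) (E : Fin n → Fin n → Prop) : Finset (Fin n) :=
  Finset.univ.filter (fun y => dY E y ≤ k + 1)

lemma mem_Ys {n k : ℕ} {E : Fin n → Fin n → Prop} {y : Fin n} : y ∈ Ys k E ↔ dY E y ≤ k + 1 := by
  simp [Ys]

noncomputable def Xs {n : ℕ} (k : ℕ) (E : Fin n → Fin n → Prop) : Finset (Fin n) :=
  Finset.univ.filter (fun x => dX E x ≤ k + 1)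

lemma mem_Xs {n k : ℕ} {E : Fin n → Fin n → Prop} {y : Fin n} : y ∈ Xs k E ↔ dX E y ≤ k + 1 := by
  simp [Xs]

lemma Cond.Ys_card {n k : ℕ} {E : Fin n → Fin n → Prop} (h : Cond n k E) :
    (Ys k E).card ≤ k + 1 := by
  by_contra hcon
  push Not at hcon
  have a1 : (Ys k E).card * (n - (k + 1)) ≤ ∑ y, cY E y := by
    calc (Ys k E).card * (n - (k + 1)) = ∑ y ∈ Ys k E, (n - (k + 1)) := by
          rw [Finset.sum_const, smul_eq_mul]
      _ ≤ ∑ y ∈ Ys k E, cY E y := by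
          refine Finset.sum_le_sum ?_
          intro y hy
          have := mem_Ys.1 hy
          have := dY_add_cY E y
          omega
      _ ≤ _ := Finset.sum_le_sum_of_subset (Finset.subset_univ _)
  have a3 := h.few
  rw [sum_c] at a3
  have hn := h.hn
  have hk1 : k + 1 ≤ n := by nlinarith
  obtain ⟨m, hm⟩ := Nat.exists_eq_add_of_le hk1
  have : n - (k + 1) = m := by omega
  rw [this] at a1
  have a4 : (k + 2) * m ≤ (Ys k E).card * m := Nat.mul_le_mul_right _ hcon
  have a5 := lt_of_le_of_lt (a4.trans a1) a3
  rw [hm] at hn a5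
  nlinarith

lemma Cond.large {n k : ℕ} {E : Fin n → Fin n → Prop} (h : Cond n k E) {x y : Fin n}
    (hx : x ∉ Xs k E) (hy : y ∉ Ys k E) : E x y := by
  by_contra hcon
  have a1 := h.nonadj x y hcon
  have a2 : n ≤ dY E y + (k + 1) := (h.dich y).resolve_left (fun h => hy (mem_Ys.2 h))
  have a3 : n ≤ dX E x + (k + 1) := (h.flip.dich x).resolve_left (fun h => hx (mem_Xs.2 h))
  have hn := h.hn
  have : 2 * (k + 1) < n := by nlinarith
  omega

lemma Cond.le_Xs {n k : ℕ} {E : Fin n → Fin n → Prop} (h : Cond n k E) {x : Fin n}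
    (hx : x ∈ Xs k E) : k ≤ (Xs k E).card := by
  have hb := h.Ys_card
  have hd := mem_Xs.1 hx
  have hn := h.hn
  have hn2 : 2 * (k + 1) < n := by nlinarith
  have : ∃ y, y ∉ Ys k E ∧ ¬ E x y := by
    by_contra hcon
    push Not at hcon
    have : (Finset.univ : Finset (Fin n)) ⊆ Ys k E ∪ Finset.univ.filter (fun y => E x y) := by
      intro y _
      by_cases hy : y ∈ Ys k E
      · exact Finset.mem_union_left _ hy
      · exact Finset.mem_union_right _ (by simpa using hcon y hy)
    have a1 := (Finset.card_le_card this).trans (Finset.card_union_le _ _)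
    rw [Finset.card_univ, Fintype.card_fin] at a1
    change n ≤ _ + dX E x at a1
    omega
  obtain ⟨y, hy, hxy⟩ := this
  have a1 := h.nonadj x y hxy
  have a2 := h.kx x
  have a3 : cY E y ≤ (Xs k E).card := by
    refine Finset.card_le_card ?_
    intro z hz
    simp only [Finset.mem_filter, Finset.mem_univ, true_and] at hz
    by_contra hzz
    exact hz (h.large hzz hy)
  have := dY_add_cY E y
  omega

lemma Cond.one_side {n k : ℕ} {E : Fin n → Fin n → Prop} (h : Cond n k E) :
    Xs k E = ∅ ∨ Ys k E = ∅ := by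
  by_contra hcon
  push Not at hcon
  obtain ⟨⟨x, hx⟩, ⟨y, hy⟩⟩ := hcon
  have a1 := h.le_Xs hx
  have a2 : k ≤ (Ys k E).card := h.flip.le_Xs hy
  have a3 := h.Ys_card
  have a4 : (Xs k E).card ≤ k + 1 := h.flip.Ys_card
  have hn := h.hn
  have hk := h.hk
  set a := (Xs k E).card with ha
  set b := (Ys k E).card with hb
  have hn2 : 2 * (k + 1) < n := by nlinarith
  obtain ⟨m, hm⟩ := Nat.exists_eq_add_of_le (show 2 * (k + 1) ≤ n by omega)
  have c1 : a * (k + 1 + m) ≤ ∑ x ∈ Xs k E, cX E x := by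
    rw [ha, ← smul_eq_mul]
    refine Finset.card_nsmul_le_sum _ _ _ ?_
    intro x hx
    have := mem_Xs.1 hx
    have := dX_add_cX E x
    omega
  have c2 : b * (k + 1 + m - a) ≤
      ∑ y ∈ Ys k E, ((Xs k E)ᶜ.filter (fun x => ¬ E x y)).card := by
    rw [hb, ← smul_eq_mul]
    refine Finset.card_nsmul_le_sum _ _ _ ?_
    intro y hy
    have e1 := mem_Ys.1 hy
    have e2 := dY_add_cY E y
    have e3 : cY E y ≤ (Xs k E).card + ((Xs k E)ᶜ.filter (fun x => ¬ E x y)).card := by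
      refine le_trans (Finset.card_le_card ?_) (Finset.card_union_le _ _)
      intro z hz
      simp only [Finset.mem_filter, Finset.mem_univ, true_and, Finset.mem_union,
        Finset.mem_compl] at hz ⊢
      tauto
    omega
  have c3 : ∑ y ∈ Ys k E, ((Xs k E)ᶜ.filter (fun x => ¬ E x y)).card =
      ∑ x ∈ (Xs k E)ᶜ, ((Ys k E).filter (fun y => ¬ E x y)).card :=
    (Finset.sum_card_bipartiteAbove_eq_sum_card_bipartiteBelow (fun x y => ¬ E x y)).symm
  have c4 : ∑ x ∈ (Xs k E)ᶜ, ((Ys k E).filter (fun y => ¬ E x y)).card ≤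
      ∑ x ∈ (Xs k E)ᶜ, cX E x := by
    refine Finset.sum_le_sum ?_
    intro x _
    exact Finset.card_le_card (Finset.filter_subset_filter _ (Finset.subset_univ _))
  have c5 := Finset.sum_add_sum_compl (Xs k E) (fun x => cX E x)
  have c6 := h.few
  have c7 : a * (k + 1 + m) + b * (k + 1 + m - a) < n * (k + 1) := by omega
  rw [hm] at c7 hn
  obtain ⟨j, rfl⟩ := Nat.exists_eq_add_of_le hk
  clear_value a b
  have hA : a = 2 + j ∨ a = 2 + j + 1 := by omega
  have hB : b = 2 + j ∨ b = 2 + j + 1 := by omega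
  rcases hA with rfl | rfl
  · have : 2 + j + 1 + m - (2 + j) = m + 1 := by omega
    rw [this] at c7
    rcases hB with rfl | rfl <;> nlinarith
  · have : 2 + j + 1 + m - (2 + j + 1) = m := by omega
    rw [this] at c7
    rcases hB with rfl | rfl <;> nlinarith


noncomputable def N {n : ℕ} (E : Fin n → Fin n → Prop) (y : Fin n) : Finset (Fin n) :=
  Finset.univ.filter (fun x => E x y)

lemma mem_N {n : ℕ} {E : Fin n → Fin n → Prop} {x y : Fin n} : x ∈ N E y ↔ E x y := by
  simp [N]

lemma card_N {n : ℕ} (E : Fin n → Fin n → Prop) (y : Fin n) : (N E y).card = dY E y := rfl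

lemma N_mono {n : ℕ} {E F : Fin n → Fin n → Prop} (h : E ≤ F) (y : Fin n) : N E y ⊆ N F y := by
  intro x hx
  exact mem_N.2 (h _ _ (mem_N.1 hx))

lemma Cond.star {n k : ℕ} {E : Fin n → Fin n → Prop} (h : Cond n k E) (hX : Xs k E = ∅)
    {x y : Fin n} (hxy : ¬ E x y) :
    ((Ys k E).filter (fun z => E x z)).card + dY E y ≤ (Ys k E).card := by
  have a1 := h.nonadj x y hxy
  have a2 := dX_add_cX E x
  have a3 : cX E x ≤ ((Ys k E).filter (fun z => ¬ E x z)).card := by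
    refine Finset.card_le_card ?_
    intro z hz
    simp only [Finset.mem_filter, Finset.mem_univ, true_and] at hz ⊢
    refine ⟨?_, hz⟩
    by_contra hzz
    exact hz (h.large (by simp [hX]) hzz)
  have a4 := Finset.card_filter_add_card_filter_not (s := Ys k E) (fun z => E x z)
  omega

lemma Cond.mono {n k : ℕ} {E F : Fin n → Fin n → Prop} (h : Cond n k E) (hEF : E ≤ F)
    (hF : ∀ x y, ¬ F x y → dX F x + dY F y ≤ n) : Cond n k F where
  nonadj := hF
  kx x := (h.kx x).trans (dX_mono hEF x)
  ky x := (h.ky x).trans (dY_mono hEF x)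
  few := by
    refine lt_of_le_of_lt (Finset.sum_le_sum ?_) h.few
    intro x _
    have a1 := dX_add_cX E x
    have a2 := dX_add_cX F x
    have a3 := dX_mono hEF x
    omega
  hk := h.hk
  hn := h.hn

lemma Cond.exists_non {n k : ℕ} {E : Fin n → Fin n → Prop} (h : Cond n k E) {y : Fin n}
    (hy : y ∈ Ys k E) : ∃ x x', ¬ E x y ∧ ¬ E x' y ∧ x ≠ x' := by
  have a1 := mem_Ys.1 hy
  have a2 := dY_add_cY E y
  have hn := h.hn
  have : 2 * (k + 1) < n := by nlinarith
  have hk := h.hk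
  have a3 : 1 < cY E y := by omega
  rw [cY, Finset.one_lt_card] at a3
  obtain ⟨x, hx, x', hx', hne⟩ := a3
  exact ⟨x, x', by simpa using hx, by simpa using hx', hne⟩

lemma Cond.step {n k : ℕ} {E : Fin n → Fin n → Prop} (h : Cond n k E) (hX : Xs k E = ∅)
    (hnt : ¬ HP E) {x₀ y₀ : Fin n} (hy₀ : y₀ ∈ Ys k E) (hxy : ¬ E x₀ y₀) :
    (Ys k E).card = k + 1 ∧
    ((∀ y ∈ Ys k E, y ≠ y₀ → dY E y = k ∧ ∀ y' ∈ Ys k E, y' ≠ y₀ → N E y = N E y') ∨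
     (dY E y₀ = k ∧ ∀ y ∈ Ys k E, N E y ⊆ insert x₀ (N E y₀))) := by
  have hn := h.hn
  have hn2 : 2 * (k + 1) < n := by nlinarith
  have hk := h.hk
  have hno : ¬ HC (addE E x₀ y₀) := fun hc => hnt (HP_of_HC_add (by omega) hc)
  obtain ⟨F, hF1, hF2, hF3⟩ := exists_max HC _ hno
  have hEF : E ≤ F := (le_addE E x₀ y₀).trans hF1
  have hF : Cond n k F := h.mono hEF
    (fun x y hxy => HC_closure (by omega) (hF3 x y hxy) hF2)
  have hXF : Xs k F = ∅ := by
    rw [Finset.eq_empty_iff_forall_notMem] at hX ⊢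
    intro x hx
    refine hX x (mem_Xs.2 ?_)
    have := mem_Xs.1 hx
    have := dX_mono hEF x
    omega
  have hsub : Ys k F ⊆ Ys k E := by
    intro y hy
    have := mem_Ys.1 hy
    have := dY_mono hEF y
    exact mem_Ys.2 (by omega)
  have hne : (Ys k F).Nonempty := by
    by_contra hcon
    rw [Finset.not_nonempty_iff_eq_empty] at hcon
    exact hF2 (HC_complete (by omega) (fun x y => hF.large (by simp [hXF]) (by simp [hcon])))
  have hbE := h.Ys_card
  have hble := Finset.card_le_card hsub
  have hins : insert x₀ (N E y₀) ⊆ N F y₀ := by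
    rw [Finset.insert_subset_iff]
    exact ⟨mem_N.2 (hF1 _ _ (Or.inr ⟨rfl, rfl⟩)), N_mono hEF y₀⟩
  have hicard : (insert x₀ (N E y₀)).card = dY E y₀ + 1 := by
    rw [Finset.card_insert_of_notMem (fun h => hxy (mem_N.1 h)), card_N]
  have hd0 : dY E y₀ + 1 ≤ dY F y₀ := by
    rw [← hicard, ← card_N]; exact Finset.card_le_card hins
  have hky₀ := h.ky y₀
  have hb1 : k ≤ (Ys k F).card := by
    obtain ⟨y, hy⟩ := hne
    obtain ⟨x, _, hx, _⟩ := hF.exists_non hy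
    have := hF.star hXF hx
    have := hF.ky y
    omega
  -- a vertex of degree equal to the number of small vertices dominates
  have dom : ∀ y, dY F y = (Ys k F).card → ∀ z ∈ Ys k F, N F z ⊆ N F y := by
    intro y hy z hz x hx
    by_contra hxy
    have := hF.star hXF (fun h => hxy (mem_N.2 h))
    have h0 : ((Ys k F).filter (fun z => F x z)).card = 0 := by omega
    rw [Finset.card_eq_zero, Finset.filter_eq_empty_iff] at h0
    exact h0 hz (mem_N.1 hx)
  rcases Nat.lt_or_ge (Ys k F).card (k + 1) with hlt | hge
  · have hbk : (Ys k F).card = k := by omega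
    have hdk : ∀ y ∈ Ys k F, dY F y = k := by
      intro y hy
      obtain ⟨x, _, hx, _⟩ := hF.exists_non hy
      have := hF.star hXF hx
      have := hF.ky y
      omega
    have hy0 : y₀ ∉ Ys k F := by
      intro hh
      have := hdk y₀ hh
      omega
    have hsub2 : Ys k F ⊆ (Ys k E).erase y₀ := fun y hy =>
      Finset.mem_erase.2 ⟨fun he => hy0 (he ▸ hy), hsub hy⟩
    have hc2 := Finset.card_le_card hsub2
    rw [Finset.card_erase_of_mem hy₀] at hc2
    have hbe : (Ys k E).card = k + 1 := by omega
    refine ⟨hbe, Or.inl ?_⟩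
    have heq : Ys k F = (Ys k E).erase y₀ := by
      refine Finset.eq_of_subset_of_card_le hsub2 ?_
      rw [Finset.card_erase_of_mem hy₀]; omega
    have hNE : ∀ y ∈ Ys k E, y ≠ y₀ → dY E y = k ∧ N E y = N F y ∧ y ∈ Ys k F := by
      intro y hy hyne
      have hyF : y ∈ Ys k F := by rw [heq]; exact Finset.mem_erase.2 ⟨hyne, hy⟩
      have a1 := hdk y hyF
      have a2 := h.ky y
      have a3 := dY_mono hEF y
      refine ⟨by omega, Finset.eq_of_subset_of_card_le (N_mono hEF y) ?_, hyF⟩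
      rw [card_N, card_N]; omega
    intro y hy hyne
    obtain ⟨b1, b2, b3⟩ := hNE y hy hyne
    refine ⟨b1, ?_⟩
    intro y' hy' hyne'
    obtain ⟨b1', b2', b3'⟩ := hNE y' hy' hyne'
    rw [b2, b2']
    exact Finset.Subset.antisymm (dom y' (by rw [hdk y' b3', hbk]) y b3)
      (dom y (by rw [hdk y b3, hbk]) y' b3')
  · have hbe : (Ys k E).card = k + 1 := by omega
    refine ⟨hbe, Or.inr ?_⟩
    have heq : Ys k F = Ys k E := Finset.eq_of_subset_of_card_le hsub (by omega)
    have a1 := mem_Ys.1 (heq ▸ hy₀ : y₀ ∈ Ys k F)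
    refine ⟨by omega, ?_⟩
    have heq2 : insert x₀ (N E y₀) = N F y₀ := by
      refine Finset.eq_of_subset_of_card_le hins ?_
      rw [hicard, card_N]; omega
    intro y hy
    rw [heq2]
    exact (N_mono hEF y).trans (dom y₀ (by omega) y (heq ▸ hy))

lemma Cond.final {n k : ℕ} {E : Fin n → Fin n → Prop} (h : Cond n k E) (hX : Xs k E = ∅)
    (hnt : ¬ HP E) : ∃ S T : Finset (Fin n), S.card = k ∧ T.card = k + 1 ∧
      ∀ x y, E x y → x ∈ S ∨ y ∉ T := by
  have hn := h.hn
  have hn2 : 2 * (k + 1) < n := by nlinarith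
  have hk := h.hk
  have hne : (Ys k E).Nonempty := by
    by_contra hcon
    rw [Finset.not_nonempty_iff_eq_empty] at hcon
    exact hnt (HC_complete (by omega) (fun x y => h.large (by simp [hX]) (by simp [hcon]))).hp
  have hcard : (Ys k E).card = k + 1 := by
    obtain ⟨y, hy⟩ := hne
    obtain ⟨x, _, hx, _⟩ := h.exists_non hy
    exact (h.step hX hnt hy hx).1
  suffices hs : ∃ y, dY E y = k ∧ ∀ z ∈ Ys k E, N E z ⊆ N E y by
    obtain ⟨y, hy, hz⟩ := hs
    refine ⟨N E y, Ys k E, hy, hcard, ?_⟩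
    intro a b hab
    by_cases hb : b ∈ Ys k E
    · exact Or.inl (hz b hb (mem_N.2 hab))
    · exact Or.inr hb
  by_cases hall : ∀ y₀ ∈ Ys k E,
      (∀ y ∈ Ys k E, y ≠ y₀ → dY E y = k ∧ ∀ y' ∈ Ys k E, y' ≠ y₀ → N E y = N E y')
  · obtain ⟨a, b, c, ha, hb, hc, hab, hac, hbc⟩ := Finset.two_lt_card_iff.1 (by omega : 2 < (Ys k E).card)
    refine ⟨c, (hall a ha c hc (Ne.symm hac)).1, ?_⟩
    intro z hz
    by_cases hza : z = a
    · subst hza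
      exact ((hall b hb z hz hab).2 c hc (Ne.symm hbc)).le
    · exact ((hall a ha z hz hza).2 c hc (Ne.symm hac)).le
  · push Not at hall
    obtain ⟨y₀, hy₀, y, hy, hyne, hcon⟩ := hall
    obtain ⟨x, x', hx, hx', hxx⟩ := h.exists_non hy₀
    have key : ∀ x₀, ¬ E x₀ y₀ → (dY E y₀ = k ∧ ∀ y ∈ Ys k E, N E y ⊆ insert x₀ (N E y₀)) := by
      intro x₀ hx₀
      rcases (h.step hX hnt hy₀ hx₀).2 with hh | hh
      · obtain ⟨b1, b2⟩ := hh y hy hyne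
        obtain ⟨y', hy', hyne', hb⟩ := hcon b1
        exact absurd (b2 y' hy' hyne') hb
      · exact hh
    refine ⟨y₀, (key x hx).1, ?_⟩
    intro z hz w hw
    have c1 := (key x hx).2 z hz hw
    have c2 := (key x' hx').2 z hz hw
    rw [Finset.mem_insert] at c1 c2
    rcases c1 with c1 | c1
    · rcases c2 with c2 | c2
      · exact absurd (c1.symm.trans c2) hxx
      · exact c2
    · exact c1

/-- The edge-count theorem. -/
theorem comb {n k : ℕ} {E : Fin n → Fin n → Prop} (hk : 2 ≤ k) (hn : (k + 2) ^ 2 ≤ n)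
    (kx : ∀ x, k ≤ dX E x) (ky : ∀ y, k ≤ dY E y) (few : ∑ x, cX E x < n * (k + 1))
    (hnt : ¬ HP E) : ∃ S T : Finset (Fin n), S.card = k ∧ T.card = k + 1 ∧
      ((∀ x y, E x y → x ∈ S ∨ y ∉ T) ∨ (∀ x y, E x y → y ∈ S ∨ x ∉ T)) := by
  have hn2 : 2 ≤ n := by nlinarith
  obtain ⟨F, hEF, hF2, hF3⟩ := exists_max HP _ hnt
  have hF : Cond n k F := by
    refine ⟨fun x y hxy => HP_closure hn2 (hF3 x y hxy) hF2, fun x => (kx x).trans (dX_mono hEF x),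
      fun x => (ky x).trans (dY_mono hEF x), ?_, hk, hn⟩
    refine lt_of_le_of_lt (Finset.sum_le_sum ?_) few
    intro x _
    have a1 := dX_add_cX E x
    have a2 := dX_add_cX F x
    have a3 := dX_mono hEF x
    omega
  rcases hF.one_side with h | h
  · obtain ⟨S, T, hS, hT, hh⟩ := hF.final h hF2
    exact ⟨S, T, hS, hT, Or.inl fun x y hxy => hh x y (hEF _ _ hxy)⟩
  · obtain ⟨S, T, hS, hT, hh⟩ := hF.flip.final h (fun hh => hF2 (HP_flip hh))
    exact ⟨S, T, hS, hT, Or.inr fun x y hxy => hh y x (hEF _ _ hxy)⟩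


section spectral
open Matrix

variable {V : Type*} [Fintype V] [DecidableEq V]

lemma bdd_spec (A : Matrix V V ℝ) (hA : A.IsHermitian) {μ : ℝ} (h : μ ∈ spectrum ℝ A) :
    μ ≤ sSup (spectrum ℝ A) := by
  refine le_csSup ?_ h
  rw [hA.spectrum_real_eq_range_eigenvalues]
  exact (Set.finite_range _).bddAbove

lemma psd_spec (A : Matrix V V ℝ) (hA : A.IsHermitian) :
    (algebraMap ℝ (Matrix V V ℝ) (sSup (spectrum ℝ A)) - A).PosSemidef := by
  have hH : (algebraMap ℝ (Matrix V V ℝ) (sSup (spectrum ℝ A)) - A).IsHermitian := by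
    refine Matrix.IsHermitian.sub ?_ hA
    rw [Matrix.algebraMap_eq_diagonal]
    exact Matrix.isHermitian_diagonal _
  rw [hH.posSemidef_iff_eigenvalues_nonneg]
  intro i
  have h1 := hH.eigenvalues_mem_spectrum_real i
  rw [← spectrum.singleton_sub_eq, Set.singleton_sub] at h1
  obtain ⟨μ, hμ, hh⟩ := h1
  have := bdd_spec A hA hμ
  simp only [Pi.zero_apply]
  rw [← hh]
  simpa using this

lemma alg_mulVec (A : Matrix V V ℝ) (r : ℝ) (v : V → ℝ) :
    (algebraMap ℝ (Matrix V V ℝ) r - A) *ᵥ v = r • v - A *ᵥ v := by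
  rw [Matrix.sub_mulVec, Algebra.algebraMap_eq_smul_one, Matrix.smul_mulVec, Matrix.one_mulVec]

lemma ray (A : Matrix V V ℝ) (hA : A.IsHermitian) (v : V → ℝ) :
    v ⬝ᵥ (A *ᵥ v) ≤ sSup (spectrum ℝ A) * (v ⬝ᵥ v) := by
  have := (psd_spec A hA).dotProduct_mulVec_nonneg v
  rw [alg_mulVec, dotProduct_sub, dotProduct_smul] at this
  simpa using this

lemma ray_eq (A : Matrix V V ℝ) (hA : A.IsHermitian) (v : V → ℝ)
    (h : sSup (spectrum ℝ A) * (v ⬝ᵥ v) ≤ v ⬝ᵥ (A *ᵥ v)) :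
    A *ᵥ v = sSup (spectrum ℝ A) • v := by
  have h1 := ray A hA v
  have := ((psd_spec A hA).dotProduct_mulVec_zero_iff v).1 (by
    rw [alg_mulVec, dotProduct_sub, dotProduct_smul]
    simp only [star_trivial, smul_eq_mul]
    linarith)
  rw [alg_mulVec, sub_eq_zero] at this
  exact this.symm

lemma exists_perron [Nonempty V] (A : Matrix V V ℝ) (hA : A.IsHermitian)
    (hpos : ∀ i j, 0 ≤ A i j) :
    ∃ z : V → ℝ, z ≠ 0 ∧ (∀ i, 0 ≤ z i) ∧ A *ᵥ z = sSup (spectrum ℝ A) • z := by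
  have hmem : sSup (spectrum ℝ A) ∈ spectrum ℝ A := by
    have hfin : (spectrum ℝ A).Finite := by
      rw [hA.spectrum_real_eq_range_eigenvalues]; exact Set.finite_range _
    have hne : (spectrum ℝ A).Nonempty := by
      rw [hA.spectrum_real_eq_range_eigenvalues]; exact Set.range_nonempty _
    exact hne.csSup_mem hfin
  rw [← Matrix.spectrum_toLin', ← Module.End.hasEigenvalue_iff_mem_spectrum,
    Matrix.spectrum_toLin'] at hmem
  obtain ⟨v, hv⟩ := hmem.exists_hasEigenvector
  have hv1 := hv.apply_eq_smul
  rw [Matrix.toLin'_apply] at hv1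
  refine ⟨fun i => |v i|, ?_, fun i => abs_nonneg _, ?_⟩
  · intro h0
    apply hv.2
    funext i
    have := congrFun h0 i
    simpa using this
  · apply ray_eq A hA
    have e1 : (fun i => |v i|) ⬝ᵥ (fun i => |v i|) = v ⬝ᵥ v := by
      simp [dotProduct]
    have e2 : sSup (spectrum ℝ A) * (v ⬝ᵥ v) = v ⬝ᵥ (A *ᵥ v) := by
      rw [hv1, dotProduct_smul, smul_eq_mul]
    rw [e1, e2]
    simp only [dotProduct, mulVec, Finset.mul_sum]
    refine Finset.sum_le_sum fun i _ => Finset.sum_le_sum fun j _ => ?_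
    calc v i * (A i j * v j) ≤ |v i * (A i j * v j)| := le_abs_self _
      _ = _ := by rw [abs_mul, abs_mul, abs_of_nonneg (hpos i j)]

set_option linter.unusedSectionVars false in
lemma adj_herm (G : SimpleGraph V) : (G.adjMatrix ℝ).IsHermitian := G.isHermitian_adjMatrix ℝ

set_option linter.unusedSectionVars false in
lemma adj_nonneg (G : SimpleGraph V) (i j : V) : 0 ≤ G.adjMatrix ℝ i j := by
  rw [SimpleGraph.adjMatrix_apply]; split_ifs <;> norm_num

lemma specRad_iso {W : Type*} [Fintype W] [DecidableEq W] {G : SimpleGraph V} {H : SimpleGraph W}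
    (φ : G ≃g H) : specRad G = specRad H := by
  unfold specRad
  have : Matrix.reindexAlgEquiv ℝ ℝ φ.toEquiv (G.adjMatrix ℝ) = H.adjMatrix ℝ := by
    ext i j
    rw [Matrix.coe_reindexAlgEquiv, Matrix.reindex_apply, Matrix.submatrix_apply,
      SimpleGraph.adjMatrix_apply, SimpleGraph.adjMatrix_apply]
    have : G.Adj (φ.toEquiv.symm i) (φ.toEquiv.symm j) ↔ H.Adj i j :=
      φ.symm.map_adj_iff
    simp only [this]
  rw [← this, AlgEquiv.spectrum_eq]

/-- A proper subgraph of a graph with two adjacent-type vertices has smaller radius. -/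
lemma eq_of_specRad_le [Nonempty V] {G Q : SimpleGraph V} (hle : G ≤ Q)
    (hρ : specRad Q ≤ specRad G)
    (hconn : ∀ P : V → Prop, (∃ v, P v) → (∀ v w, P v → Q.Adj v w → P w) → ∀ v, P v) : G = Q := by
  obtain ⟨z, hz0, hz, hGz⟩ := exists_perron (G.adjMatrix ℝ) (adj_herm G) (adj_nonneg G)
  have hzz : 0 ≤ z ⬝ᵥ z := by
    simp only [dotProduct]
    exact Finset.sum_nonneg fun i _ => mul_self_nonneg _
  have hent : ∀ i j, G.adjMatrix ℝ i j ≤ Q.adjMatrix ℝ i j := by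
    intro i j
    rw [SimpleGraph.adjMatrix_apply, SimpleGraph.adjMatrix_apply]
    by_cases h : G.Adj i j
    · rw [if_pos h, if_pos (hle h)]
    · rw [if_neg h]; split_ifs <;> norm_num
  have h1 : z ⬝ᵥ (G.adjMatrix ℝ *ᵥ z) ≤ z ⬝ᵥ (Q.adjMatrix ℝ *ᵥ z) := by
    simp only [dotProduct, mulVec]
    refine Finset.sum_le_sum fun i _ => mul_le_mul_of_nonneg_left
      (Finset.sum_le_sum fun j _ => mul_le_mul_of_nonneg_right (hent i j) (hz j)) (hz i)
  have h2 := ray (Q.adjMatrix ℝ) (adj_herm Q) z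
  have h3 : z ⬝ᵥ (G.adjMatrix ℝ *ᵥ z) = specRad G * (z ⬝ᵥ z) := by
    rw [hGz, dotProduct_smul, smul_eq_mul]; rfl
  change _ ≤ specRad Q * _ at h2
  have h4 := mul_le_mul_of_nonneg_right hρ hzz
  have hQz : Q.adjMatrix ℝ *ᵥ z = specRad Q • z :=
    ray_eq (Q.adjMatrix ℝ) (adj_herm Q) z (by change specRad Q * _ ≤ _; linarith)
  have hzpos : ∀ v, z v ≠ 0 := by
    by_contra hcon
    push Not at hcon
    apply hz0
    funext v
    refine hconn (fun v => z v = 0) hcon ?_ v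
    intro a b ha hab
    have e := congrFun hQz a
    rw [Pi.smul_apply, ha, smul_zero] at e
    simp only [mulVec, dotProduct] at e
    rw [Finset.sum_eq_zero_iff_of_nonneg
      (fun j _ => mul_nonneg (adj_nonneg Q a j) (hz j))] at e
    have := e b (Finset.mem_univ _)
    rw [SimpleGraph.adjMatrix_apply, if_pos hab, one_mul] at this
    exact this
  have hq : z ⬝ᵥ (Q.adjMatrix ℝ *ᵥ z) ≤ z ⬝ᵥ (G.adjMatrix ℝ *ᵥ z) := by linarith
  refine le_antisymm hle ?_
  intro a b hab
  by_contra hG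
  have : z ⬝ᵥ (G.adjMatrix ℝ *ᵥ z) < z ⬝ᵥ (Q.adjMatrix ℝ *ᵥ z) := by
    simp only [dotProduct, mulVec]
    have zp : ∀ v, 0 < z v := fun v => lt_of_le_of_ne (hz v) (Ne.symm (hzpos v))
    refine Finset.sum_lt_sum (fun i _ => mul_le_mul_of_nonneg_left
      (Finset.sum_le_sum fun j _ => mul_le_mul_of_nonneg_right (hent i j) (hz j)) (hz i))
      ⟨a, Finset.mem_univ _, mul_lt_mul_of_pos_left (Finset.sum_lt_sum
        (fun j _ => mul_le_mul_of_nonneg_right (hent a j) (hz j))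
        ⟨b, Finset.mem_univ _, mul_lt_mul_of_pos_right ?_ (zp b)⟩) (zp a)⟩
    rw [SimpleGraph.adjMatrix_apply, SimpleGraph.adjMatrix_apply, if_pos hab, if_neg hG]
    norm_num
  linarith

end spectral


section bip
open Matrix

/-- the biadjacency relation -/
def rel {n : ℕ} (G : SimpleGraph (Fin n ⊕ Fin n)) : Fin n → Fin n → Prop :=
  fun x y => G.Adj (Sum.inl x) (Sum.inr y)

/-- the biadjacency matrix entries -/
noncomputable def ent {n : ℕ} (E : Fin n → Fin n → Prop) (x y : Fin n) : ℝ :=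
  if E x y then 1 else 0

lemma mulVec_inl {n : ℕ} {G : SimpleGraph (Fin n ⊕ Fin n)} (hb : CrossOnly G)
    (z : Fin n ⊕ Fin n → ℝ) (x : Fin n) :
    (G.adjMatrix ℝ *ᵥ z) (Sum.inl x) = ∑ y, ent (rel G) x y * z (Sum.inr y) := by
  simp only [mulVec, dotProduct, Fintype.sum_sum_type, SimpleGraph.adjMatrix_apply]
  simp [hb.1]
  refine Finset.sum_congr rfl fun y _ => ?_
  by_cases h : rel G x y
  · have h' : G.Adj (Sum.inl x) (Sum.inr y) := h
    rw [ent, if_pos h, if_pos h', one_mul]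
  · have h' : ¬ G.Adj (Sum.inl x) (Sum.inr y) := h
    rw [ent, if_neg h, if_neg h', zero_mul]

lemma mulVec_inr {n : ℕ} {G : SimpleGraph (Fin n ⊕ Fin n)} (hb : CrossOnly G)
    (z : Fin n ⊕ Fin n → ℝ) (y : Fin n) :
    (G.adjMatrix ℝ *ᵥ z) (Sum.inr y) = ∑ x, ent (rel G) x y * z (Sum.inl x) := by
  simp only [mulVec, dotProduct, Fintype.sum_sum_type, SimpleGraph.adjMatrix_apply]
  simp [hb.2, G.adj_comm (Sum.inr y)]
  refine Finset.sum_congr rfl fun x _ => ?_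
  by_cases h : rel G x y
  · have h' : G.Adj (Sum.inl x) (Sum.inr y) := h
    rw [ent, if_pos h, if_pos h', one_mul]
  · have h' : ¬ G.Adj (Sum.inl x) (Sum.inr y) := h
    rw [ent, if_neg h, if_neg h', zero_mul]

lemma sum_ent_sq {n : ℕ} (E : Fin n → Fin n → Prop) (x : Fin n) :
    ∑ y, ent E x y ^ 2 = (dX E x : ℝ) := by
  simp [ent, dX, ite_pow]

lemma sum_ent_sq' {n : ℕ} (E : Fin n → Fin n → Prop) (y : Fin n) :
    ∑ x, ent E x y ^ 2 = (dY E y : ℝ) := by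
  simp [ent, dY, ite_pow]

lemma sum_d {n : ℕ} (E : Fin n → Fin n → Prop) : ∑ x, dX E x = ∑ y, dY E y :=
  Finset.sum_card_bipartiteAbove_eq_sum_card_bipartiteBelow (fun x y => E x y)

lemma specRad_sq_le {n : ℕ} [DecidableEq (Fin n ⊕ Fin n)] (h0 : 0 < n)
    {G : SimpleGraph (Fin n ⊕ Fin n)}
    (hb : CrossOnly G) : specRad G ^ 2 ≤ ((∑ x, dX (rel G) x : ℕ) : ℝ) := by
  have : Nonempty (Fin n ⊕ Fin n) := ⟨Sum.inl ⟨0, h0⟩⟩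
  obtain ⟨z, hz0, hz, hGz⟩ := exists_perron (G.adjMatrix ℝ) (adj_herm G) (adj_nonneg G)
  change _ = specRad G • z at hGz
  set ρ := specRad G with hρ
  set e : ℝ := ((∑ x, dX (rel G) x : ℕ) : ℝ) with he
  set U := ∑ x, z (Sum.inl x) ^ 2 with hU
  set W := ∑ y, z (Sum.inr y) ^ 2 with hW
  have h1 : ρ ^ 2 * U ≤ e * W := by
    rw [hU, Finset.mul_sum, he, Nat.cast_sum, Finset.sum_mul]
    refine Finset.sum_le_sum fun x _ => ?_
    have a1 := congrFun hGz (Sum.inl x)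
    rw [mulVec_inl hb, Pi.smul_apply, smul_eq_mul] at a1
    rw [← mul_pow, ← a1, ← sum_ent_sq]
    exact Finset.sum_mul_sq_le_sq_mul_sq _ _ _
  have h2 : ρ ^ 2 * W ≤ e * U := by
    rw [hW, Finset.mul_sum, he, sum_d, Nat.cast_sum, Finset.sum_mul]
    refine Finset.sum_le_sum fun y _ => ?_
    have a1 := congrFun hGz (Sum.inr y)
    rw [mulVec_inr hb, Pi.smul_apply, smul_eq_mul] at a1
    rw [← mul_pow, ← a1, ← sum_ent_sq']
    exact Finset.sum_mul_sq_le_sq_mul_sq _ _ _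
  have h3 : 0 < U + W := by
    have : U + W = ∑ v, z v ^ 2 := by rw [Fintype.sum_sum_type]
    rw [this]
    obtain ⟨v, hv⟩ := Function.ne_iff.1 hz0
    refine Finset.sum_pos' (fun i _ => sq_nonneg _) ⟨v, Finset.mem_univ _, ?_⟩
    have : z v ≠ 0 := hv
    positivity
  have h4 : ρ ^ 2 * (U + W) ≤ e * (U + W) := by linarith
  exact le_of_mul_le_mul_right h4 h3

lemma Q_cross (n k : ℕ) : CrossOnly (Qgraph n k) := by
  constructor <;> intro x y <;> simp [Qgraph]

lemma Q_adj {n k : ℕ} {x y : Fin n} :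
    (Qgraph n k).Adj (Sum.inl x) (Sum.inr y) ↔ (x.val < k ∨ y.val < n - k - 1) := by
  simp [Qgraph]

lemma ray_Q {n : ℕ} [DecidableEq (Fin n ⊕ Fin n)] {k m : ℕ} (hm : n = m + (k + 1)) (s t r : ℝ) :
    2 * (m * (n * s * t) + (k + 1) * (k * s * r)) ≤
      specRad (Qgraph n k) * (n * s ^ 2 + (m * t ^ 2 + (k + 1) * r ^ 2)) := by
  set z : Fin n ⊕ Fin n → ℝ := Sum.elim (fun _ => s) (fun y => if y.val < m then t else r) with hz
  have h := ray ((Qgraph n k).adjMatrix ℝ) (adj_herm _) z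
  change _ ≤ specRad (Qgraph n k) * _ at h
  have c1 : (Finset.univ.filter (fun y : Fin n => y.val < m)).card = m := by
    rw [Fin.card_filter_val_lt]; omega
  have c2 : (Finset.univ.filter (fun y : Fin n => ¬ y.val < m)).card = k + 1 := by
    have := Finset.card_filter_add_card_filter_not (s := (Finset.univ : Finset (Fin n)))
      (fun y => y.val < m)
    rw [c1, Finset.card_univ, Fintype.card_fin] at this
    omega
  have c3 : (Finset.univ.filter (fun y : Fin n => y.val < k)).card = k := by
    rw [Fin.card_filter_val_lt]; omega
  have hsum : ∀ a b : ℝ, ∑ y : Fin n, (if y.val < m then a else b) = m * a + (k + 1) * b := by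
    intro a b
    rw [Finset.sum_ite, Finset.sum_const, Finset.sum_const, c1, c2]
    simp
  have hzz : z ⬝ᵥ z = n * s ^ 2 + (m * t ^ 2 + (k + 1) * r ^ 2) := by
    rw [← hsum]
    simp only [dotProduct, Fintype.sum_sum_type, hz, Sum.elim_inl, Sum.elim_inr]
    congr 1
    · simp [sq]
    · refine Finset.sum_congr rfl fun y _ => ?_
      split_ifs <;> ring
  have hent : ∀ y : Fin n, ∑ x, ent (rel (Qgraph n k)) x y * s =
      if y.val < m then n * s else k * s := by
    intro y
    have hm' : n - k - 1 = m := by omega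
    rw [← Finset.sum_mul]
    split_ifs with hy
    · simp [ent, rel, Q_adj, hm', hy]
    · simp only [ent, rel, Q_adj, hm', hy, or_false]
      rw [Finset.sum_boole, c3]
  have hA : ∑ y, z (Sum.inr y) * ∑ x, ent (rel (Qgraph n k)) x y * z (Sum.inl x) =
      m * (n * s * t) + (k + 1) * (k * s * r) := by
    rw [← hsum]
    refine Finset.sum_congr rfl fun y _ => ?_
    simp only [hz, Sum.elim_inl, Sum.elim_inr]
    rw [hent]
    split_ifs <;> ring
  have hB : ∑ x, z (Sum.inl x) * ∑ y, ent (rel (Qgraph n k)) x y * z (Sum.inr y) =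
      m * (n * s * t) + (k + 1) * (k * s * r) := by
    rw [← hA]
    simp only [Finset.mul_sum]
    rw [Finset.sum_comm]
    refine Finset.sum_congr rfl fun y _ => Finset.sum_congr rfl fun x _ => ?_
    ring
  have hzA : z ⬝ᵥ ((Qgraph n k).adjMatrix ℝ *ᵥ z) =
      2 * (m * (n * s * t) + (k + 1) * (k * s * r)) := by
    rw [dotProduct, Fintype.sum_sum_type]
    simp only [mulVec_inl (Q_cross n k), mulVec_inr (Q_cross n k)]
    rw [hA, hB]; ring
  rw [hzz, hzA] at h
  exact h

lemma Q_sq {n : ℕ} [DecidableEq (Fin n ⊕ Fin n)] {k m : ℕ} (hm : n = m + (k + 1)) (hk : 2 ≤ k)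
    (hm0 : 0 < m) : ((n * m : ℕ) : ℝ) < specRad (Qgraph n k) ^ 2 ∧ 0 < specRad (Qgraph n k) := by
  set ρ := specRad (Qgraph n k) with hρ
  have hn0 : (0 : ℝ) < n := by exact_mod_cast (by omega : 0 < n)
  have hm1 : (0 : ℝ) < m := by exact_mod_cast hm0
  have hk1 : (2 : ℝ) ≤ k := by exact_mod_cast hk
  have hpos : 0 < ρ := by
    have h := ray_Q (n := n) hm 1 1 0
    rw [← hρ] at h
    by_contra hcon
    have : ρ * (n * 1 ^ 2 + (m * 1 ^ 2 + (k + 1) * 0 ^ 2)) ≤ 0 :=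
      mul_nonpos_of_nonpos_of_nonneg (not_lt.1 hcon) (by positivity)
    have : (0 : ℝ) < 2 * (m * (n * 1 * 1) + (k + 1) * (k * 1 * 0)) := by
      simp; positivity
    linarith
  refine ⟨?_, hpos⟩
  have h := ray_Q (n := n) hm ρ n 1
  rw [← hρ] at h
  have h2 : ρ * (2 * (m * (n * n) + (k + 1) * k)) ≤
      ρ * (n * ρ ^ 2 + (m * n ^ 2 + (k + 1) * 1 ^ 2)) := by
    refine le_trans (le_of_eq ?_) h
    ring
  have h3 := le_of_mul_le_mul_left h2 hpos
  have h4 : (n : ℝ) * (n * m) < n * ρ ^ 2 := by nlinarith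
  push_cast
  exact lt_of_mul_lt_mul_left h4 hn0.le

lemma traceable_of_HP {n : ℕ} (h0 : 0 < n) {G : SimpleGraph (Fin n ⊕ Fin n)} (h : HP (rel G)) :
    G.IsTraceable := by
  obtain ⟨f, g, hf, hg, e1, e2⟩ := h
  set p : ℕ → Fin n ⊕ Fin n := fun j => if j % 2 = 0 then Sum.inl (f (j / 2)) else Sum.inr (g (j / 2))
    with hp
  have hadj : ∀ j, j + 1 < 2 * n → G.Adj (p j) (p (j + 1)) := by
    intro j hj
    simp only [hp]
    split_ifs with c1 c2 c2
    · omega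
    · have : (j + 1) / 2 = j / 2 := by omega
      rw [this]
      exact e1 _ (by omega)
    · have : (j + 1) / 2 = j / 2 + 1 := by omega
      rw [this]
      exact (e2 _ (by omega)).symm
    · omega
  have hinj : ∀ i j, i < 2 * n → j < 2 * n → p i = p j → i = j := by
    intro i j hi hj hij
    simp only [hp] at hij
    split_ifs at hij with c1 c2 c2
    · have := hf _ _ (by omega) (by omega) (Sum.inl_injective hij); omega
    · have := hg _ _ (by omega) (by omega) (Sum.inr_injective hij); omega
  have hw : ∀ m, m < 2 * n → ∃ w : G.Walk (p 0) (p m), w.support = (List.range (m + 1)).map p := by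
    intro m
    induction m with
    | zero =>
      intro _
      exact ⟨SimpleGraph.Walk.nil, by simp⟩
    | succ m ih =>
      intro hm
      obtain ⟨w, hw⟩ := ih (by omega)
      refine ⟨w.concat (hadj m hm), ?_⟩
      rw [SimpleGraph.Walk.support_concat, hw, List.range_succ (n := m + 1)]
      simp
  obtain ⟨w, hw⟩ := hw (2 * n - 1) (by omega)
  have h2n : 2 * n - 1 + 1 = 2 * n := by omega
  rw [h2n] at hw
  have hpath : w.IsPath := by
    rw [SimpleGraph.Walk.isPath_def, hw]
    refine List.Nodup.map_on ?_ List.nodup_range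
    intro a ha b hb hab
    exact hinj a b (by simpa using ha) (by simpa using hb) hab
  have hmem : ∀ v, v ∈ w.support := by
    intro v
    rw [hw, List.mem_map]
    rcases v with x | y
    · obtain ⟨i, hi, rfl⟩ := surj_of hf x
      refine ⟨2 * i, by simp; omega, ?_⟩
      simp [hp]
    · obtain ⟨i, hi, rfl⟩ := surj_of hg y
      refine ⟨2 * i + 1, by simp; omega, ?_⟩
      have : (2 * i + 1) / 2 = i := by omega
      simp [hp, this, Nat.add_mod]
  refine ⟨_, _, w, ?_⟩
  convert SimpleGraph.Walk.IsPath.isHamiltonian_of_mem hpath hmem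

lemma exists_perm {n k : ℕ} (S : Finset (Fin n)) (hS : S.card = k) :
    ∃ σ : Equiv.Perm (Fin n), ∀ x, (σ x).val < k ↔ x ∈ S := by
  have hkn : k ≤ n := by rw [← hS]; simpa using Finset.card_le_univ S
  have hc : Fintype.card {x : Fin n // x ∈ S} = Fintype.card {x : Fin n // x.val < k} := by
    rw [Fintype.card_coe, hS, Fintype.card_subtype, Fin.card_filter_val_lt]; omega
  let e := Fintype.equivOfCardEq hc
  refine ⟨e.extendSubtype, fun x => ⟨fun h => ?_, fun h => e.extendSubtype_mem x h⟩⟩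
  by_contra hx
  exact e.extendSubtype_not_mem x hx h

lemma Q_conn {n k : ℕ} (hk : 0 < k) (hn : k + 1 < n) (P : Fin n ⊕ Fin n → Prop)
    (h1 : ∃ v, P v) (h2 : ∀ v w, P v → (Qgraph n k).Adj v w → P w) : ∀ v, P v := by
  have hx : ∀ y : Fin n, (Qgraph n k).Adj (Sum.inl ⟨0, by omega⟩) (Sum.inr y) :=
    fun y => Q_adj.2 (Or.inl hk)
  have hy : ∀ x : Fin n, (Qgraph n k).Adj (Sum.inl x) (Sum.inr ⟨0, by omega⟩) :=
    fun x => Q_adj.2 (Or.inr (by simp; omega))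
  have key : P (Sum.inl ⟨0, by omega⟩) := by
    obtain ⟨v, hv⟩ := h1
    rcases v with x | y
    · exact h2 _ _ (h2 _ _ hv (hy x)) (hy _).symm
    · exact h2 _ _ hv (hx y).symm
  intro v
  rcases v with x | y
  · exact h2 _ _ (h2 _ _ key (hx ⟨0, by omega⟩)) (hy x).symm
  · exact h2 _ _ key (hx y)

lemma iso_of_embed {n k : ℕ} [DecidableEq (Fin n ⊕ Fin n)] (hk : 0 < k) (hn : k + 1 < n)
    {G : SimpleGraph (Fin n ⊕ Fin n)}
    (hρ : specRad (Qgraph n k) ≤ specRad G) (e : Fin n ⊕ Fin n ≃ Fin n ⊕ Fin n)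
    (he : ∀ a b, G.Adj a b → (Qgraph n k).Adj (e a) (e b)) : Nonempty (G ≃g Qgraph n k) := by
  have : Nonempty (Fin n ⊕ Fin n) := ⟨Sum.inl ⟨0, by omega⟩⟩
  have φ : G ≃g G.map e.toEmbedding := SimpleGraph.Iso.map e G
  have hle : G.map e.toEmbedding ≤ Qgraph n k := by
    rw [SimpleGraph.map_le_iff_le_comap]
    intro a b hab
    exact he a b hab
  have := eq_of_specRad_le hle (by rw [← specRad_iso φ]; exact hρ) (Q_conn hk hn)
  rw [this] at φ
  exact ⟨φ⟩

lemma deg_inl {n : ℕ} {G : SimpleGraph (Fin n ⊕ Fin n)} (hb : CrossOnly G) (x : Fin n) :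
    G.degree (Sum.inl x) = dX (rel G) x := by
  rw [dX, ← SimpleGraph.card_neighborFinset_eq_degree,
    ← Finset.card_map (Function.Embedding.inr : Fin n ↪ Fin n ⊕ Fin n)]
  congr 1
  ext v
  rcases v with a | b
  · simp [hb.1]
  · simp [rel]
    exact ⟨fun h => Finset.mem_filter.2 ⟨Finset.mem_univ _, h⟩, fun h => (Finset.mem_filter.1 h).2⟩

lemma deg_inr {n : ℕ} {G : SimpleGraph (Fin n ⊕ Fin n)} (hb : CrossOnly G) (y : Fin n) :
    G.degree (Sum.inr y) = dY (rel G) y := by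
  rw [dY, ← SimpleGraph.card_neighborFinset_eq_degree,
    ← Finset.card_map (Function.Embedding.inl : Fin n ↪ Fin n ⊕ Fin n)]
  congr 1
  ext v
  rcases v with a | b
  · simp [rel, G.adj_comm (Sum.inr y)]
    exact ⟨fun h => Finset.mem_filter.2 ⟨Finset.mem_univ _, h⟩, fun h => (Finset.mem_filter.1 h).2⟩
  · simp [hb.2]

end bip

end BipTrace

/-- A balanced bipartite graph on `2n` vertices with `δ(G) ≥ k ≥ 2`, `n ≥ (k+2)²` and
`ρ(G) ≥ ρ(Q_n^k)` is traceable unless `G = Q_n^k`. -/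
theorem stmt_14 (n k : ℕ) (G : SimpleGraph (Fin n ⊕ Fin n)) (hbip : CrossOnly G)
    (hk : 2 ≤ k) (hn : (k + 2) ^ 2 ≤ n) (hdeg : ∀ v, k ≤ G.degree v)
    (hρ : specRad (Qgraph n k) ≤ specRad G) :
    G.IsTraceable ∨ Nonempty (G ≃g Qgraph n k) := by
  classical
  have hn2 : 2 * (k + 1) < n := by nlinarith
  obtain ⟨m, hm⟩ := Nat.exists_eq_add_of_le' (show k + 1 ≤ n by omega)
  by_cases hnt : BipTrace.HP (BipTrace.rel G)
  · exact Or.inl (BipTrace.traceable_of_HP (by omega) hnt)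
  right
  have kx : ∀ x, k ≤ BipTrace.dX (BipTrace.rel G) x := fun x => by
    rw [← BipTrace.deg_inl hbip]; exact hdeg _
  have ky : ∀ y, k ≤ BipTrace.dY (BipTrace.rel G) y := fun y => by
    rw [← BipTrace.deg_inr hbip]; exact hdeg _
  have few : ∑ x, BipTrace.cX (BipTrace.rel G) x < n * (k + 1) := by
    obtain ⟨h1, h2⟩ := BipTrace.Q_sq hm hk (by omega)
    have h3 := BipTrace.specRad_sq_le (by omega) hbip
    have h4 := pow_le_pow_left₀ h2.le hρ 2
    have h5 := lt_of_lt_of_le h1 (h4.trans h3)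
    rw [Nat.cast_lt] at h5
    have h6 : ∑ x, BipTrace.dX (BipTrace.rel G) x + ∑ x, BipTrace.cX (BipTrace.rel G) x = n * n := by
      rw [← Finset.sum_add_distrib, Finset.sum_congr rfl
        (fun x _ => BipTrace.dX_add_cX (BipTrace.rel G) x)]
      simp
    have h7 : n * n = n * m + n * (k + 1) := by rw [← mul_add, ← hm]
    omega
  obtain ⟨S, T, hS, hT, hh⟩ := BipTrace.comb hk hn kx ky few hnt
  obtain ⟨σ, hσ⟩ := BipTrace.exists_perm S hS
  have hTc : (Tᶜ).card = n - k - 1 := by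
    rw [Finset.card_compl, Fintype.card_fin, hT]; omega
  obtain ⟨τ, hτ⟩ := BipTrace.exists_perm Tᶜ hTc
  have hτ' : ∀ y, (τ y).val < n - k - 1 ↔ y ∉ T := fun y => by rw [hτ y, Finset.mem_compl]
  rcases hh with hh | hh
  · have key : ∀ x y, G.Adj (Sum.inl x) (Sum.inr y) →
        (Qgraph n k).Adj (Sum.inl (σ x)) (Sum.inr (τ y)) := fun x y hxy =>
      BipTrace.Q_adj.2 ((hh x y hxy).imp (hσ x).2 (hτ' y).2)
    refine BipTrace.iso_of_embed (by omega) (by omega) hρ (Equiv.sumCongr σ τ) ?_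
    rintro (x | y) (x' | y') hab
    · exact absurd hab (hbip.1 _ _)
    · exact key _ _ hab
    · exact (key _ _ hab.symm).symm
    · exact absurd hab (hbip.2 _ _)
  · have key : ∀ x y, G.Adj (Sum.inl x) (Sum.inr y) →
        (Qgraph n k).Adj (Sum.inl (σ y)) (Sum.inr (τ x)) := fun x y hxy =>
      BipTrace.Q_adj.2 ((hh x y hxy).imp (hσ y).2 (hτ' x).2)
    refine BipTrace.iso_of_embed (by omega) (by omega) hρ
      ((Equiv.sumComm _ _).trans (Equiv.sumCongr σ τ)) ?_
    rintro (x | y) (x' | y') hab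
    · exact absurd hab (hbip.1 _ _)
    · exact (key _ _ hab).symm
    · exact key _ _ hab.symm
    · exact absurd hab (hbip.2 _ _)
end

section
/- Let G be a balanced bipartite graph on 2n vertices with δ(G) ≥ 1 and n ≥ 9. If ρ(G) ≥ ρ(R_n^1) = n − 1, then G is traceable unless G = R_n^1. -/
open SimpleGraph

attribute [local instance] Classical.propDecidable

/-- Hamilton path as a list. -/
def HP {V : Type*} (G : SimpleGraph V) : Prop :=
  ∃ l : List V, l.Nodup ∧ (∀ v, v ∈ l) ∧ l.IsChain G.Adj

lemma HP.traceable {V : Type*} [Nonempty V] {G : SimpleGraph V} (h : HP G) : G.IsTraceable := by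
  obtain ⟨l, hn, hm, hc⟩ := h
  have hne : l ≠ [] := by
    rintro rfl
    exact absurd (hm (Classical.arbitrary V)) (by simp)
  refine ⟨_, _, Walk.ofSupport l hne hc, ?_⟩
  apply Walk.IsPath.isHamiltonian_of_mem
  · apply Walk.IsPath.mk'
    rw [Walk.support_ofSupport]; exact hn
  · intro w
    rw [Walk.support_ofSupport]; exact hm w

/-- A balanced bipartition. -/
structure Bip {V : Type*} (G : SimpleGraph V) (X Y : Finset V) (n : ℕ) : Prop where
  disj : ∀ v, v ∈ X → v ∈ Y → False
  cov : ∀ v, v ∈ X ∨ v ∈ Y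
  cX : X.card = n
  cY : Y.card = n
  adj : ∀ a b, G.Adj a b → (a ∈ X ∧ b ∈ Y) ∨ (a ∈ Y ∧ b ∈ X)

lemma Bip.symm {V : Type*} {G : SimpleGraph V} {X Y : Finset V} {n : ℕ} (h : Bip G X Y n) :
    Bip G Y X n :=
  ⟨fun v a b => h.disj v b a, fun v => (h.cov v).symm, h.cY, h.cX, fun a b k => (h.adj a b k).symm⟩

/-- neighbours as a finset -/
noncomputable def nb {V : Type*} [Fintype V] (G : SimpleGraph V) (v : V) : Finset V :=
  Finset.univ.filter (G.Adj v)

lemma mem_nb {V : Type*} [Fintype V] {G : SimpleGraph V} {v w : V} : w ∈ nb G v ↔ G.Adj v w := by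
  simp [nb]

lemma Bip.nb_sub {V : Type*} [Fintype V] {G : SimpleGraph V} {X Y : Finset V} {n : ℕ}
    (h : Bip G X Y n) {x : V} (hx : x ∈ X) : nb G x ⊆ Y := by
  intro y hy
  rw [mem_nb] at hy
  rcases h.adj _ _ hy with h1 | h1
  · exact h1.2
  · exact (h.disj x hx h1.1).elim

lemma sum_alt {V : Type*} (f : V → ℤ) : ∀ (l : List V) (hl : l ≠ []),
    l.IsChain (fun a b => f a = - f b) →
    2 * (l.map f).sum = f (l.head hl) + f (l.getLast hl)
  | [], hl, _ => absurd rfl hl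
  | [a], _, _ => by simp; ring
  | a :: b :: l, _, h => by
    have ih := sum_alt f (b :: l) (by simp) h.of_cons
    have h1 := h.rel
    rw [List.map_cons, List.sum_cons, mul_add, ih]
    simp only [List.head_cons, List.getLast_cons_cons]
    rw [h1]; ring

lemma reroute {V : Type*} {G : SimpleGraph V} {A B S T : List V} {u v y x : V}
    (h1 : (v :: B).IsChain G.Adj) (h2 : (A ++ [u]).IsChain G.Adj)
    (hn : (v :: B ++ (A ++ [u])).Nodup) (hm : ∀ w, w ∈ (v :: B ++ (A ++ [u])))
    (hST : v :: B ++ (A ++ [u]) = (S ++ [y]) ++ (x :: T))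
    (hy : G.Adj u y) (hx : G.Adj v x) : HP G := by
  have hS : (S ++ [y]).head? = some v := by
    have := congrArg List.head? hST
    cases S <;> simp at this ⊢ <;> simp [this]
  have hT : (x :: T).getLast? = some u := by
    have := congrArg List.getLast? hST
    rw [List.getLast?_append_of_ne_nil (S ++ [y]) (by simp : x :: T ≠ [])] at this
    rw [← this, ← List.append_assoc, List.getLast?_append]; simp
  rcases List.append_eq_append_iff.1 hST with ⟨S2, e1, e2⟩ | ⟨T1, e1, e2⟩
  · -- S ++ [y] = v :: B ++ S2,  A ++ [u] = S2 ++ x :: T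
    rw [e2, List.isChain_append] at h2
    refine ⟨S2 ++ ((x :: T).reverse ++ (v :: B)), ?_, ?_, ?_⟩
    · rw [e2] at hn
      refine List.Perm.nodup ?_ hn
      refine List.perm_append_comm.trans ?_
      rw [List.append_assoc]
      refine List.Perm.append_left _ (List.Perm.append_right _ (List.reverse_perm _).symm)
    · intro w
      have := hm w
      rw [e2] at this
      simp only [List.mem_append, List.mem_reverse] at this ⊢
      tauto
    · rw [List.isChain_append, List.isChain_append]
      refine ⟨h2.1, ⟨?_, h1, ?_⟩, ?_⟩
      · rw [List.isChain_reverse]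
        exact h2.2.1.imp (fun a b h => h.symm)
      · intro a ha b hb
        simp at ha hb
        subst ha hb; exact hx.symm
      · intro a ha b hb
        rw [List.head?_append, List.head?_reverse, hT] at hb
        simp at hb
        subst hb
        have : a = y := by
          have e3 := congrArg List.getLast? e1
          rw [List.getLast?_append, List.getLast?_append, ha] at e3
          simpa using e3.symm
        rw [this]; exact hy.symm
  · rw [e1, List.isChain_append] at h1
    refine ⟨T1.reverse ++ ((S ++ [y]) ++ (A ++ [u]).reverse), ?_, ?_, ?_⟩
    · rw [e1] at hn
      refine List.Perm.nodup ?_ hn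
      refine (List.Perm.append_right _ List.perm_append_comm).trans ?_
      rw [List.append_assoc]
      refine List.Perm.append (List.reverse_perm _).symm (List.Perm.append_left _ (List.reverse_perm _).symm)
    · intro w
      have := hm w
      rw [e1] at this
      simp only [List.mem_append, List.mem_reverse] at this ⊢
      tauto
    · rw [List.isChain_append, List.isChain_append]
      refine ⟨?_, ⟨h1.1, ?_, ?_⟩, ?_⟩
      · rw [List.isChain_reverse]
        exact h1.2.1.imp (fun a b h => h.symm)
      · rw [List.isChain_reverse]
        exact h2.imp (fun a b h => h.symm)
      · intro a ha b hb
        simp at ha hb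
        subst ha hb; exact hy.symm
      · intro a ha b hb
        rw [List.head?_append, hS] at hb
        simp at hb
        subst hb
        have : a = x := by
          have e3 := congrArg List.head? e2
          rw [List.getLast?_reverse] at ha
          rw [List.head?_append, ha] at e3
          simpa using e3.symm
        rw [this]; exact hx.symm

lemma cross_aux {V : Type*} [Fintype V] {G : SimpleGraph V} {X Y : Finset V} {n : ℕ}
    (hB : Bip G X Y n) {u v : V} (hu : u ∈ X) (hv : v ∈ Y) (hnt : ¬ HP G)
    {A B : List V} (hnd : (A ++ u :: v :: B).Nodup) (hm : ∀ w, w ∈ (A ++ u :: v :: B))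
    (h1 : (v :: B).IsChain G.Adj) (h2 : (A ++ [u]).IsChain G.Adj) :
    (nb G u).card + (nb G v).card ≤ n := by
  have hperm : List.Perm (A ++ u :: v :: B) (v :: B ++ (A ++ [u])) := by
    refine List.Perm.trans ?_ List.perm_append_comm
    simp
  have hnd' := hperm.nodup hnd
  have hm' : ∀ w, w ∈ v :: B ++ (A ++ [u]) := fun w => hperm.subset (hm w)
  let C : V → V → Prop := fun a b => (a ∈ X ∧ b ∈ Y) ∨ (a ∈ Y ∧ b ∈ X)
  have c1 : (v :: B).IsChain C := h1.imp (fun a b h => hB.adj a b h)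
  have c2 : (A ++ [u]).IsChain C := h2.imp (fun a b h => hB.adj a b h)
  let f : V → ℤ := fun a => if a ∈ X then 1 else -1
  have hf : ∀ a b, C a b → f a = - f b := by
    intro a b h
    rcases h with h | h
    · have : b ∉ X := fun k => hB.disj b k h.2
      simp [f, h.1, this]
    · have : a ∉ X := fun k => hB.disj a k h.1
      simp [f, h.2, this]
  have hlC : (A ++ u :: v :: B).IsChain C := by
    rw [List.isChain_append_cons_cons]
    exact ⟨c2, Or.inl ⟨hu, hv⟩, c1⟩
  have hne : A ++ u :: v :: B ≠ [] := by simp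
  have hs := sum_alt f _ hne (hlC.imp hf)
  have hs0 : ((A ++ u :: v :: B).map f).sum = 0 := by
    rw [← List.sum_toFinset f hnd]
    have : (A ++ u :: v :: B).toFinset = Finset.univ := by
      ext w; simpa only [List.mem_toFinset, Finset.mem_univ, iff_true] using hm w
    rw [this]
    have hYX : Finset.univ.filter (fun a => a ∉ X) = Y := by
      ext w
      simp
      constructor
      · intro h; exact (hB.cov w).resolve_left h
      · intro h k; exact hB.disj w k h
    simp only [f]
    rw [Finset.sum_ite]
    rw [hYX]
    simp [hB.cX, hB.cY]
  rw [hs0] at hs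
  have hRC : (v :: B ++ (A ++ [u])).IsChain C := by
    rw [List.isChain_append]
    refine ⟨c1, c2, ?_⟩
    intro a ha b hb
    have e1 : (A ++ u :: v :: B).getLast hne = a := by
      have : (A ++ u :: v :: B).getLast? = some a := by
        rw [List.getLast?_append_of_ne_nil _ (by simp), List.getLast?_cons_cons]
        exact ha
      rw [List.getLast?_eq_some_getLast hne] at this
      simpa using this
    have e2 : (A ++ u :: v :: B).head hne = b := by
      have : (A ++ u :: v :: B).head? = some b := by
        cases A <;> simpa using hb
      rw [List.head?_eq_some_head hne] at this
      simpa using this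
    rw [e1, e2] at hs
    simp only [f] at hs
    by_cases ka : a ∈ X <;> by_cases kb : b ∈ X <;> simp [ka, kb] at hs
    · exact Or.inl ⟨ka, (hB.cov b).resolve_left kb⟩
    · exact Or.inr ⟨(hB.cov a).resolve_left ka, kb⟩
  have key : ∀ y, y ∈ nb G u → ∃ x, x ∈ X ∧ ¬ G.Adj v x ∧
      ∃ S T, v :: B ++ (A ++ [u]) = (S ++ [y]) ++ (x :: T) := by
    intro y hy
    have hyY := hB.nb_sub hu hy
    rw [mem_nb] at hy
    obtain ⟨S, T, e⟩ := List.append_of_mem (hm' y)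
    cases T with
    | nil =>
      exfalso
      have := congrArg List.getLast? e
      simp at this
      rw [List.getLast?_cons] at this
      simp at this
      exact hy.ne this
    | cons x T =>
      have e' : v :: B ++ (A ++ [u]) = (S ++ [y]) ++ (x :: T) := by rw [e]; simp
      refine ⟨x, ?_, ?_, S, T, e'⟩
      · rw [e, List.isChain_append_cons_cons] at hRC
        rcases hRC.2.1 with k | k
        · exact (hB.disj y k.1 hyY).elim
        · exact k.2
      · intro hx
        exact hnt (reroute h1 h2 hnd' hm' e' hy hx)
  choose! s hsX hsv S T hST using key
  have hinj : Set.InjOn s (nb G u : Set V) := by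
    intro y hy y' hy' hyy
    have a1 := hST y hy
    have a2 := hST y' hy'
    rw [hyy] at a1
    have n1 := hnd'
    rw [a1] at n1
    have n2 := hnd'
    rw [a2] at n2
    have e := a1.symm.trans a2
    rw [List.append_cons_inj_of_notMem] at e
    · have := e.1
      simpa using (List.append_inj' this rfl).2
    · intro k
      exact (List.disjoint_of_nodup_append n1) k (by simp)
    · intro k
      exact (List.nodup_cons.1 (List.Nodup.of_append_right n1)).1 k
  rw [← Finset.card_image_of_injOn hinj, ← Finset.card_union_of_disjoint, ← hB.cX]
  · apply Finset.card_le_card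
    intro w hw
    rw [Finset.mem_union, Finset.mem_image] at hw
    rcases hw with ⟨y, hy, rfl⟩ | hw
    · exact hsX y hy
    · exact hB.symm.nb_sub hv hw
  · rw [Finset.disjoint_left]
    intro w hw
    rw [Finset.mem_image] at hw
    obtain ⟨y, hy, rfl⟩ := hw
    rw [mem_nb]
    exact hsv y hy

lemma cross {V : Type*} [Fintype V] {G : SimpleGraph V} {X Y : Finset V} {n : ℕ}
    (hB : Bip G X Y n) {u v : V} (hu : u ∈ X) (hv : v ∈ Y) (hnt : ¬ HP G)
    (h : HP (G ⊔ SimpleGraph.edge u v)) :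
    (nb G u).card + (nb G v).card ≤ n := by
  obtain ⟨l, hnd, hm, hc⟩ := h
  have hnc : ¬ l.IsChain G.Adj := fun k => hnt ⟨l, hnd, hm, k⟩
  have : ∃ A B, l = A ++ u :: v :: B ∨ l = A ++ v :: u :: B := by
    rw [List.isChain_iff_forall_rel_of_append_cons_cons] at hnc
    push Not at hnc
    obtain ⟨p, q, A, B, e, hpq⟩ := hnc
    refine ⟨A, B, ?_⟩
    rw [e, List.isChain_append_cons_cons] at hc
    have := hc.2.1
    rw [SimpleGraph.sup_adj, SimpleGraph.edge_adj] at this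
    rcases this with h | ⟨⟨rfl, rfl⟩ | ⟨rfl, rfl⟩, _⟩
    · exact absurd h hpq
    · left; exact e
    · right; exact e
  have main : ∃ A B, (A ++ u :: v :: B).Nodup ∧ (∀ w, w ∈ (A ++ u :: v :: B)) ∧
      (A ++ u :: v :: B).IsChain (G ⊔ SimpleGraph.edge u v).Adj := by
    obtain ⟨A, B, rfl | rfl⟩ := this
    · exact ⟨A, B, hnd, hm, hc⟩
    · have e : B.reverse ++ u :: v :: A.reverse = (A ++ v :: u :: B).reverse := by simp
      refine ⟨B.reverse, A.reverse, ?_, ?_, ?_⟩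
      · rw [e]; exact List.nodup_reverse.2 hnd
      · rw [e]; intro w; exact List.mem_reverse.2 (hm w)
      · rw [e, List.isChain_reverse]
        exact hc.imp (fun a b h => h.symm)
  clear this hnd hm hc hnc l
  obtain ⟨A, B, hnd, hm, hc⟩ := main
  rw [List.isChain_append_cons_cons] at hc
  have hd : (A ++ [u] ++ v :: B).Nodup := by simpa using hnd
  have hdj := List.disjoint_of_nodup_append hd
  refine cross_aux hB hu hv hnt hnd hm ?_ ?_
  · refine hc.2.2.imp_of_mem_imp ?_
    intro a b ha hb hab
    rw [SimpleGraph.sup_adj, SimpleGraph.edge_adj] at hab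
    rcases hab with h | ⟨⟨rfl, rfl⟩ | ⟨rfl, rfl⟩, _⟩
    · exact h
    · exact (hdj (by simp) ha).elim
    · exact (hdj (by simp) hb).elim
  · refine hc.1.imp_of_mem_imp ?_
    intro a b ha hb hab
    rw [SimpleGraph.sup_adj, SimpleGraph.edge_adj] at hab
    rcases hab with h | ⟨⟨rfl, rfl⟩ | ⟨rfl, rfl⟩, _⟩
    · exact h
    · exact (hdj hb (by simp)).elim
    · exact (hdj ha (by simp)).elim

lemma inter {V : Type*} {G : SimpleGraph V} : ∀ (k : ℕ) (S T : Finset V), S.card = k → T.card = k →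
    (∀ v, v ∈ S → v ∈ T → False) → (∀ x ∈ S, ∀ y ∈ T, G.Adj x y) →
    ∃ l : List V, l.Nodup ∧ (∀ w, w ∈ l ↔ w ∈ S ∨ w ∈ T) ∧ l.IsChain G.Adj ∧
      (∀ a ∈ l.head?, a ∈ S) ∧ (∀ a ∈ l.getLast?, a ∈ T)
  | 0, S, T, hS, hT, _, _ => by
    rw [Finset.card_eq_zero] at hS hT
    subst hS hT
    exact ⟨[], by simp⟩
  | k + 1, S, T, hS, hT, hd, hc => by
    obtain ⟨x, hx⟩ : S.Nonempty := Finset.card_pos.1 (by omega)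
    obtain ⟨y, hy⟩ : T.Nonempty := Finset.card_pos.1 (by omega)
    obtain ⟨l, h1, h2, h3, h4, h5⟩ := inter (G := G) k (S.erase x) (T.erase y)
      (by rw [Finset.card_erase_of_mem hx]; omega) (by rw [Finset.card_erase_of_mem hy]; omega)
      (fun v a b => hd v (Finset.mem_of_mem_erase a) (Finset.mem_of_mem_erase b))
      (fun a ha b hb => hc a (Finset.mem_of_mem_erase ha) b (Finset.mem_of_mem_erase hb))
    have hxT : x ∉ T := fun h => hd x hx h
    have hyS : y ∉ S := fun h => hd y h hy
    have hxy : x ≠ y := fun h => hxT (h ▸ hy)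
    refine ⟨x :: y :: l, ?_, ?_, ?_, ?_, ?_⟩
    · simp only [List.nodup_cons, List.mem_cons, h2, Finset.mem_erase]
      tauto
    · intro w
      simp only [List.mem_cons, h2, Finset.mem_erase]
      by_cases a : w = x <;> by_cases b : w = y <;> simp_all
    · rw [List.isChain_cons_cons]
      refine ⟨hc x hx y hy, ?_⟩
      rw [List.isChain_cons]
      refine ⟨?_, h3⟩
      intro z hz
      exact (hc z (Finset.mem_of_mem_erase (h4 z hz)) y hy).symm
    · simp [hx]
    · intro a ha
      rw [List.getLast?_cons_cons, List.getLast?_cons] at ha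
      cases hl : l.getLast? with
      | none => simp [hl] at ha; subst ha; exact hy
      | some b =>
        simp [hl] at ha; subst ha
        exact Finset.mem_of_mem_erase (h5 b (by simp [hl]))

section
variable {V : Type*} [Fintype V] {G : SimpleGraph V} {X Y : Finset V} {n : ℕ}

lemma T1 (hB : Bip G X Y n) {u y0 : V} (hu : u ∈ X)
    (hc : ∀ x ∈ X, x ≠ u → ∀ y ∈ Y, G.Adj x y) (h0 : G.Adj u y0) : HP G := by
  have hy0 : y0 ∈ Y := hB.nb_sub hu (mem_nb.2 h0)
  have hd := hB.disj
  have hcov := hB.cov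
  obtain ⟨l, h1, h2, h3, h4, h5⟩ := inter (G := G) (n - 1) (X.erase u) (Y.erase y0)
    (by rw [Finset.card_erase_of_mem hu, hB.cX]) (by rw [Finset.card_erase_of_mem hy0, hB.cY])
    (fun v a b => hB.disj v (Finset.mem_of_mem_erase a) (Finset.mem_of_mem_erase b))
    (fun a ha b hb => hc a (Finset.mem_of_mem_erase ha) (Finset.ne_of_mem_erase ha) b
      (Finset.mem_of_mem_erase hb))
  refine ⟨u :: y0 :: l, ?_, ?_, ?_⟩
  · simp only [List.nodup_cons, List.mem_cons, h2, Finset.mem_erase]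
    grind
  · intro w
    simp only [List.mem_cons, h2, Finset.mem_erase]
    grind
  · rw [List.isChain_cons_cons, List.isChain_cons]
    refine ⟨h0, ?_, h3⟩
    intro z hz
    have := h4 z hz
    exact (hc z (Finset.mem_of_mem_erase this) (Finset.ne_of_mem_erase this) y0 hy0).symm

lemma T2 (hB : Bip G X Y n) (hn : 9 ≤ n) {u v y : V} (hu : u ∈ X) (hv : v ∈ Y)
    (hc : ∀ x ∈ X, x ≠ u → ∀ y ∈ Y, y ≠ v → G.Adj x y) (h0 : G.Adj u v) (h1 : G.Adj u y)
    (hyv : y ≠ v) : HP G := by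
  have hy : y ∈ Y := hB.nb_sub hu (mem_nb.2 h1)
  have hd := hB.disj
  have hcov := hB.cov
  have hXc := hB.cX
  have hYc := hB.cY
  obtain ⟨x, hx⟩ : (X.erase u).Nonempty := Finset.card_pos.1 (by
    rw [Finset.card_erase_of_mem hu]; omega)
  obtain ⟨hxu, hxX⟩ := Finset.mem_erase.1 hx
  obtain ⟨l, k1, k2, k3, k4, k5⟩ := inter (G := G) (n - 2) ((Y.erase v).erase y) ((X.erase u).erase x)
    (by rw [Finset.card_erase_of_mem (by simp [hy, hyv]), Finset.card_erase_of_mem hv]; omega)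
    (by rw [Finset.card_erase_of_mem hx, Finset.card_erase_of_mem hu]; omega)
    (by intro v a b; simp only [Finset.mem_erase] at a b; exact hd v b.2.2 a.2.2)
    (by intro a ha b hb; simp only [Finset.mem_erase] at ha hb
        exact (hc b hb.2.2 hb.2.1 a ha.2.2 ha.2.1).symm)
  refine ⟨v :: u :: y :: x :: l, ?_, ?_, ?_⟩
  · simp only [List.nodup_cons, List.mem_cons, k2, Finset.mem_erase]
    grind
  · intro w
    simp only [List.mem_cons, k2, Finset.mem_erase]
    grind
  · rw [List.isChain_cons_cons, List.isChain_cons_cons, List.isChain_cons_cons, List.isChain_cons]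
    refine ⟨h0.symm, h1, (hc x hxX hxu y hy hyv).symm, ?_, k3⟩
    intro z hz
    have := k4 z hz
    simp only [Finset.mem_erase] at this
    exact hc x hxX hxu z this.2.2 this.2.1

lemma T3 (hB : Bip G X Y n) {u v x y : V} (hu : u ∈ X) (hv : v ∈ Y)
    (hc : ∀ x ∈ X, x ≠ u → ∀ y ∈ Y, y ≠ v → G.Adj x y) (h0 : ¬ G.Adj u v) (h1 : G.Adj u y)
    (h2 : G.Adj v x) : HP G := by
  have hy : y ∈ Y := hB.nb_sub hu (mem_nb.2 h1)
  have hx : x ∈ X := hB.symm.nb_sub hv (mem_nb.2 h2)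
  have hd := hB.disj
  have hcov := hB.cov
  have hXc := hB.cX
  have hYc := hB.cY
  have hyv : y ≠ v := by rintro rfl; exact h0 h1
  have hxu : x ≠ u := by rintro rfl; exact h0 h2.symm
  obtain ⟨l, k1, k2, k3, k4, k5⟩ := inter (G := G) (n - 2) ((X.erase u).erase x) ((Y.erase v).erase y)
    (by rw [Finset.card_erase_of_mem (by simp [hx, hxu]), Finset.card_erase_of_mem hu]; omega)
    (by rw [Finset.card_erase_of_mem (by simp [hy, hyv]), Finset.card_erase_of_mem hv]; omega)
    (by intro v a b; simp only [Finset.mem_erase] at a b; exact hd v a.2.2 b.2.2)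
    (by intro a ha b hb; simp only [Finset.mem_erase] at ha hb
        exact (hc a ha.2.2 ha.2.1 b hb.2.2 hb.2.1))
  refine ⟨u :: y :: (l ++ [x, v]), ?_, ?_, ?_⟩
  · simp only [List.nodup_cons, List.mem_cons, List.nodup_append, List.mem_append, k2, Finset.mem_erase]
    grind
  · intro w
    simp only [List.mem_cons, List.mem_append, k2, Finset.mem_erase]
    grind
  · rw [List.isChain_cons_cons, List.isChain_cons, List.isChain_append]
    refine ⟨h1, ?_, k3, ?_, ?_⟩
    · intro z hz
      have : z ∈ X ∧ z ≠ u := by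
        rw [List.head?_append] at hz
        cases hl : l.head? with
        | none => simp [hl] at hz; subst hz; exact ⟨hx, hxu⟩
        | some b =>
          simp [hl] at hz; subst hz
          have := k4 b (by simp [hl])
          simp only [Finset.mem_erase] at this
          exact ⟨this.2.2, this.2.1⟩
      exact (hc z this.1 this.2 y hy hyv).symm
    · simp [h2.symm]
    · intro a ha b hb
      simp at hb; subst hb
      have := k5 a ha
      simp only [Finset.mem_erase] at this
      exact (hc x hx hxu a this.2.2 this.2.1).symm

lemma T4 (hB : Bip G X Y n) (hn : 9 ≤ n) {u u' y y1 y2 : V} (hu : u ∈ X) (hu' : u' ∈ X)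
    (huu : u ≠ u')
    (hc : ∀ x ∈ X, x ≠ u → x ≠ u' → ∀ y ∈ Y, G.Adj x y) (h0 : G.Adj u y) (h1 : G.Adj u' y1)
    (h2 : G.Adj u' y2) (h12 : y1 ≠ y2) : HP G := by
  have hy : y ∈ Y := hB.nb_sub hu (mem_nb.2 h0)
  have hy1 : y1 ∈ Y := hB.nb_sub hu' (mem_nb.2 h1)
  have hy2 : y2 ∈ Y := hB.nb_sub hu' (mem_nb.2 h2)
  have hd := hB.disj
  have hcov := hB.cov
  have hXc := hB.cX
  have hYc := hB.cY
  wlog hne : y ≠ y2 generalizing y1 y2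
  · push Not at hne
    exact this h2 h1 h12.symm hy2 hy1 (by rw [hne]; exact h12.symm)
  by_cases e : y = y1
  · subst e
    obtain ⟨l, k1, k2, k3, k4, k5⟩ := inter (G := G) (n - 2) ((X.erase u).erase u')
      ((Y.erase y).erase y2)
      (by rw [Finset.card_erase_of_mem (by simp [hu', huu.symm]), Finset.card_erase_of_mem hu]; omega)
      (by rw [Finset.card_erase_of_mem (by simp [hy2, hne.symm]), Finset.card_erase_of_mem hy]; omega)
      (by intro v a b; simp only [Finset.mem_erase] at a b; exact hd v a.2.2 b.2.2)
      (by intro a ha b hb; simp only [Finset.mem_erase] at ha hb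
          exact (hc a ha.2.2 ha.2.1 ha.1 b hb.2.2))
    refine ⟨u :: y :: u' :: y2 :: l, ?_, ?_, ?_⟩
    · simp only [List.nodup_cons, List.mem_cons, k2, Finset.mem_erase]
      grind
    · intro w
      simp only [List.mem_cons, k2, Finset.mem_erase]
      grind
    · rw [List.isChain_cons_cons, List.isChain_cons_cons, List.isChain_cons_cons, List.isChain_cons]
      refine ⟨h0, h1.symm, h2, ?_, k3⟩
      intro z hz
      have := k4 z hz
      simp only [Finset.mem_erase] at this
      exact (hc z this.2.2 this.2.1 this.1 y2 hy2).symm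
  · obtain ⟨x, hx⟩ : ((X.erase u).erase u').Nonempty := Finset.card_pos.1 (by
      rw [Finset.card_erase_of_mem (by simp [hu', huu.symm]), Finset.card_erase_of_mem hu]; omega)
    have hx' := hx
    simp only [Finset.mem_erase] at hx'
    obtain ⟨l, k1, k2, k3, k4, k5⟩ := inter (G := G) (n - 3) (((X.erase u).erase u').erase x)
      (((Y.erase y).erase y2).erase y1)
      (by rw [Finset.card_erase_of_mem hx, Finset.card_erase_of_mem (by simp [hu', huu.symm]),
            Finset.card_erase_of_mem hu]; omega)
      (by rw [Finset.card_erase_of_mem (by simp [hy1, h12, Ne.symm e]),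
            Finset.card_erase_of_mem (by simp [hy2, hne.symm]), Finset.card_erase_of_mem hy]; omega)
      (by intro v a b; simp only [Finset.mem_erase] at a b; exact hd v a.2.2.2 b.2.2.2)
      (by intro a ha b hb; simp only [Finset.mem_erase] at ha hb
          exact (hc a ha.2.2.2 ha.2.2.1 ha.2.1 b hb.2.2.2))
    refine ⟨u :: y :: x :: y1 :: u' :: y2 :: l, ?_, ?_, ?_⟩
    · simp only [List.nodup_cons, List.mem_cons, k2, Finset.mem_erase]
      grind
    · intro w
      simp only [List.mem_cons, k2, Finset.mem_erase]
      grind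
    · rw [List.isChain_cons_cons, List.isChain_cons_cons, List.isChain_cons_cons,
        List.isChain_cons_cons, List.isChain_cons_cons, List.isChain_cons]
      refine ⟨h0, (hc x hx'.2.2 hx'.2.1 hx'.1 y hy).symm, hc x hx'.2.2 hx'.2.1 hx'.1 y1 hy1,
        h1.symm, h2, ?_, k3⟩
      intro z hz
      have := k4 z hz
      simp only [Finset.mem_erase] at this
      exact (hc z this.2.2.2 this.2.2.1 this.2.1 y2 hy2).symm

lemma nb_le (hB : Bip G X Y n) {x : V} (hx : x ∈ X) : (nb G x).card ≤ n := by
  rw [← hB.cY]; exact Finset.card_le_card (hB.nb_sub hx)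

lemma nb_lt (hB : Bip G X Y n) {x y : V} (hx : x ∈ X) (hy : y ∈ Y) (h : ¬ G.Adj x y) :
    (nb G x).card + 1 ≤ n := by
  rw [← hB.cY]
  apply Finset.card_lt_card
  refine Finset.ssubset_iff_subset_ne.2 ⟨hB.nb_sub hx, ?_⟩
  intro e
  rw [← e, mem_nb] at hy
  exact h hy

lemma sum_eq (hB : Bip G X Y n) : ∑ x ∈ X, (nb G x).card = ∑ y ∈ Y, (nb G y).card := by
  have := Finset.sum_card_bipartiteAbove_eq_sum_card_bipartiteBelow (s := X) (t := Y) (fun a b => G.Adj a b)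
  convert this using 2 with x hx y hy
  · congr 1; ext w
    rw [mem_nb, Finset.mem_bipartiteAbove]
    exact ⟨fun h => ⟨hB.nb_sub hx (mem_nb.2 h), h⟩, fun h => h.2⟩
  · congr 1; ext w
    rw [mem_nb, Finset.mem_bipartiteBelow]
    exact ⟨fun h => ⟨hB.symm.nb_sub hy (mem_nb.2 h), h.symm⟩, fun h => h.2.symm⟩

lemma F1 (hB : Bip G X Y n) (hn : 9 ≤ n) (he : n ^ 2 + 1 ≤ ∑ x ∈ X, (nb G x).card + 2 * n)
    (hcl : ∀ x ∈ X, ∀ y ∈ Y, ¬ G.Adj x y → (nb G x).card + (nb G y).card ≤ n)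
    {x : V} (hx : x ∈ X) : (nb G x).card ≤ 2 ∨ n ≤ (nb G x).card + 2 := by
  by_contra hcon
  push Not at hcon
  rw [sum_eq hB] at he
  have hsub := hB.nb_sub hx
  rw [← Finset.sum_sdiff hsub] at he
  have b1 : ∑ y ∈ nb G x, (nb G y).card ≤ (nb G x).card * n := by
    rw [← smul_eq_mul]
    apply Finset.sum_le_card_nsmul
    intro y hy
    exact nb_le hB.symm (hsub hy)
  have b2 : ∑ y ∈ Y \ nb G x, (nb G y).card ≤ (n - (nb G x).card) * (n - (nb G x).card) := by
    have : (Y \ nb G x).card = n - (nb G x).card := by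
      rw [Finset.card_sdiff_of_subset hsub, hB.cY]
    nth_rewrite 1 [← this]
    rw [← smul_eq_mul]
    apply Finset.sum_le_card_nsmul
    intro y hy
    rw [Finset.mem_sdiff, mem_nb] at hy
    have := hcl x hx y hy.1 hy.2
    omega
  generalize (nb G x).card = a at *
  obtain ⟨c, rfl⟩ : ∃ c, n = a + 3 + c := ⟨n - a - 3, by omega⟩
  obtain ⟨b, rfl⟩ : ∃ b, a = b + 3 := ⟨a - 3, by omega⟩
  have e : b + 3 + 3 + c - (b + 3) = 3 + c := by omega
  rw [e] at b2
  nlinarith [Nat.zero_le (b * c)]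

lemma F2 (hB : Bip G X Y n) (hn : 9 ≤ n) (he : n ^ 2 + 1 ≤ ∑ x ∈ X, (nb G x).card + 2 * n)
    {u u' v : V} (hu : u ∈ X) (hu' : u' ∈ X) (huu : u ≠ u') (hv : v ∈ Y)
    (h1 : (nb G u).card ≤ 2) (h2 : (nb G u').card ≤ 2) (h3 : (nb G v).card ≤ 2) : False := by
  have hu'e : u' ∈ X.erase u := by simp [hu', huu.symm]
  rw [← Finset.add_sum_erase X _ hu, ← Finset.add_sum_erase _ _ hu'e] at he
  have b : ∑ x ∈ (X.erase u).erase u', (nb G x).card ≤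
      ∑ x ∈ (X.erase u).erase u', ((n - 1) + if G.Adj v x then 1 else 0) := by
    apply Finset.sum_le_sum
    intro x hx
    simp only [Finset.mem_erase] at hx
    split_ifs with h
    · have := nb_le hB hx.2.2; omega
    · have := nb_lt hB hx.2.2 hv (fun k => h k.symm); omega
  rw [Finset.sum_add_distrib, Finset.sum_const, ← Finset.card_filter, smul_eq_mul,
    Finset.card_erase_of_mem hu'e, Finset.card_erase_of_mem hu, hB.cX] at b
  have b2 : (((X.erase u).erase u').filter (G.Adj v)).card ≤ (nb G v).card := by
    apply Finset.card_le_card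
    intro w hw
    rw [Finset.mem_filter] at hw
    exact mem_nb.2 hw.2
  obtain ⟨c, rfl⟩ : ∃ c, n = c + 9 := ⟨n - 9, by omega⟩
  have e1 : c + 9 - 1 - 1 = c + 7 := by omega
  have e2 : c + 9 - 1 = c + 8 := by omega
  rw [e1, e2] at b
  nlinarith

lemma F3 (hB : Bip G X Y n) (hn : 9 ≤ n) (he : n ^ 2 + 1 ≤ ∑ x ∈ X, (nb G x).card + 2 * n)
    {u u' v : V} (hu : u ∈ X) (hu' : u' ∈ X) (huu : u ≠ u') (hv : v ∈ X) (hvu : v ≠ u) (hvu' : v ≠ u')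
    (h1 : (nb G u).card ≤ 2) (h2 : (nb G u').card ≤ 2) (h3 : (nb G v).card ≤ 2) : False := by
  have hu'e : u' ∈ X.erase u := by simp [hu', huu.symm]
  have hve : v ∈ (X.erase u).erase u' := by simp [hv, hvu, hvu']
  rw [← Finset.add_sum_erase X _ hu, ← Finset.add_sum_erase _ _ hu'e,
    ← Finset.add_sum_erase _ _ hve] at he
  have b : ∑ x ∈ ((X.erase u).erase u').erase v, (nb G x).card ≤
      (((X.erase u).erase u').erase v).card • n := by
    apply Finset.sum_le_card_nsmul
    intro x hx
    simp only [Finset.mem_erase] at hx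
    exact nb_le hB hx.2.2.2
  rw [smul_eq_mul, Finset.card_erase_of_mem hve,
    Finset.card_erase_of_mem hu'e, Finset.card_erase_of_mem hu, hB.cX] at b
  obtain ⟨c, rfl⟩ : ∃ c, n = c + 9 := ⟨n - 9, by omega⟩
  have e1 : c + 9 - 1 - 1 - 1 = c + 6 := by omega
  rw [e1] at b
  nlinarith

/-- The case of two low vertices on one side. -/
lemma two_low (hB : Bip G X Y n) (hn : 9 ≤ n) (he : n ^ 2 + 1 ≤ ∑ x ∈ X, (nb G x).card + 2 * n)
    (hδ : ∀ v, 1 ≤ (nb G v).card) (hnt : ¬ HP G)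
    (hadj : ∀ x ∈ X, ∀ y ∈ Y, 2 < (nb G x).card → 2 < (nb G y).card → G.Adj x y)
    {u u' : V} (hu : u ∈ X) (hu' : u' ∈ X) (huu : u ≠ u')
    (h1 : (nb G u).card ≤ 2) (h2 : (nb G u').card ≤ 2) :
    (nb G u).card ≤ 1 ∧ (nb G u').card ≤ 1 := by
  have hc : ∀ x ∈ X, x ≠ u → x ≠ u' → ∀ y ∈ Y, G.Adj x y := by
    intro x hx a b y hy
    apply hadj x hx y hy
    · by_contra k
      exact F3 hB hn he hu hu' huu hx a b h1 h2 (by omega)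
    · by_contra k
      exact F2 hB hn he hu hu' huu hy h1 h2 (by omega)
  constructor
  · by_contra k
    obtain ⟨y1, m1, y2, m2, h12⟩ := Finset.one_lt_card.1 (by omega : 1 < (nb G u).card)
    obtain ⟨y, hy⟩ := Finset.card_pos.1 (hδ u')
    exact hnt (T4 hB hn hu' hu huu.symm (fun x hx a b => hc x hx b a) (mem_nb.1 hy)
      (mem_nb.1 m1) (mem_nb.1 m2) h12)
  · by_contra k
    obtain ⟨y1, m1, y2, m2, h12⟩ := Finset.one_lt_card.1 (by omega : 1 < (nb G u').card)
    obtain ⟨y, hy⟩ := Finset.card_pos.1 (hδ u)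
    exact hnt (T4 hB hn hu hu' huu hc (mem_nb.1 hy)
      (mem_nb.1 m1) (mem_nb.1 m2) h12)

lemma closed_case (hB : Bip G X Y n) (hn : 9 ≤ n)
    (he : n ^ 2 + 1 ≤ ∑ x ∈ X, (nb G x).card + 2 * n)
    (hcl : ∀ x ∈ X, ∀ y ∈ Y, ¬ G.Adj x y → (nb G x).card + (nb G y).card ≤ n)
    (hδ : ∀ v, 1 ≤ (nb G v).card) (hnt : ¬ HP G) :
    (∃ u ∈ X, ∃ u' ∈ X, u ≠ u' ∧ (nb G u).card ≤ 1 ∧ (nb G u').card ≤ 1) ∨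
    (∃ u ∈ Y, ∃ u' ∈ Y, u ≠ u' ∧ (nb G u).card ≤ 1 ∧ (nb G u').card ≤ 1) ∨
    (∃ u ∈ X, ∃ v ∈ Y, (∀ y, G.Adj u y → y = v) ∧ (∀ x, G.Adj v x → x = u)) := by
  have he' := he
  rw [sum_eq hB] at he'
  have hcl' : ∀ x ∈ Y, ∀ y ∈ X, ¬ G.Adj x y → (nb G x).card + (nb G y).card ≤ n := by
    intro x hx y hy h
    rw [add_comm]; exact hcl y hy x hx (fun k => h k.symm)
  have hadj : ∀ x ∈ X, ∀ y ∈ Y, 2 < (nb G x).card → 2 < (nb G y).card → G.Adj x y := by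
    intro x hx y hy a b
    by_contra k
    have := hcl x hx y hy k
    have f1 := F1 hB hn he hcl hx
    have f2 := F1 hB.symm hn he' hcl' hy
    omega
  have hadj' : ∀ x ∈ Y, ∀ y ∈ X, 2 < (nb G x).card → 2 < (nb G y).card → G.Adj x y :=
    fun x hx y hy a b => (hadj y hy x hx b a).symm
  by_cases cX : ∃ u ∈ X, ∃ u' ∈ X, u ≠ u' ∧ (nb G u).card ≤ 2 ∧ (nb G u').card ≤ 2
  · obtain ⟨u, hu, u', hu', huu, h1, h2⟩ := cX
    exact Or.inl ⟨u, hu, u', hu', huu, two_low hB hn he hδ hnt hadj hu hu' huu h1 h2⟩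
  by_cases cY : ∃ u ∈ Y, ∃ u' ∈ Y, u ≠ u' ∧ (nb G u).card ≤ 2 ∧ (nb G u').card ≤ 2
  · obtain ⟨u, hu, u', hu', huu, h1, h2⟩ := cY
    exact Or.inr (Or.inl ⟨u, hu, u', hu', huu,
      two_low hB.symm hn he' hδ hnt hadj' hu hu' huu h1 h2⟩)
  right; right
  push Not at cX cY
  have nbr : ∀ v, ∃ w, G.Adj v w := fun v => by
    obtain ⟨y, hy⟩ := Finset.card_pos.1 (hδ v)
    exact ⟨y, mem_nb.1 hy⟩
  by_cases lX : ∃ u ∈ X, (nb G u).card ≤ 2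
  · obtain ⟨u, hu, hul⟩ := lX
    have ou : ∀ x ∈ X, x ≠ u → 2 < (nb G x).card := fun x hx hxu => cX u hu x hx hxu.symm hul
    by_cases lY : ∃ v ∈ Y, (nb G v).card ≤ 2
    · obtain ⟨v, hv, hvl⟩ := lY
      have ov : ∀ x ∈ Y, x ≠ v → 2 < (nb G x).card := fun x hx hxu => cY v hv x hx hxu.symm hvl
      have hc : ∀ x ∈ X, x ≠ u → ∀ y ∈ Y, y ≠ v → G.Adj x y :=
        fun x hx a y hy b => hadj x hx y hy (ou x hx a) (ov y hy b)
      refine ⟨u, hu, v, hv, ?_, ?_⟩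
      · intro y hy
        by_contra hyv
        by_cases huv : G.Adj u v
        · exact hnt (T2 hB hn hu hv hc huv hy hyv)
        · obtain ⟨x, hx⟩ := nbr v
          exact hnt (T3 hB hu hv hc huv hy hx)
      · intro x hx
        by_contra hxu
        by_cases huv : G.Adj u v
        · exact hnt (T2 hB.symm hn hv hu (fun y hy a x hx b => (hc x hx b y hy a).symm) huv.symm hx hxu)
        · obtain ⟨y, hy⟩ := nbr u
          exact hnt (T3 hB hu hv hc huv hy hx)
    · push Not at lY
      obtain ⟨y, hy⟩ := nbr u
      exact (hnt (T1 hB hu (fun x hx a y hy => hadj x hx y hy (ou x hx a) (lY y hy)) hy)).elim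
  · push Not at lX
    by_cases lY : ∃ v ∈ Y, (nb G v).card ≤ 2
    · obtain ⟨v, hv, hvl⟩ := lY
      have ov : ∀ x ∈ Y, x ≠ v → 2 < (nb G x).card := fun x hx hxu => cY v hv x hx hxu.symm hvl
      obtain ⟨y, hy⟩ := nbr v
      exact (hnt (T1 hB.symm hv (fun x hx a y hy => hadj' x hx y hy (ov x hx a) (lX y hy)) hy)).elim
    · push Not at lY
      obtain ⟨u, hu⟩ : X.Nonempty := Finset.card_pos.1 (by rw [hB.cX]; omega)
      obtain ⟨y, hy⟩ := nbr u
      exact (hnt (T1 hB hu (fun x hx a y hy => hadj x hx y hy (lX x hx) (lY y hy)) hy)).elim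

lemma nb_mono {G H : SimpleGraph V} (h : G ≤ H) (v : V) : nb G v ⊆ nb H v := by
  intro w hw
  rw [mem_nb] at *
  exact h hw

lemma comb (hB : Bip G X Y n) (hn : 9 ≤ n)
    (he : n ^ 2 + 1 ≤ ∑ x ∈ X, (nb G x).card + 2 * n)
    (hδ : ∀ v, 1 ≤ (nb G v).card) (hnt : ¬ HP G) :
    (∃ u ∈ X, ∃ u' ∈ X, u ≠ u' ∧ (nb G u).card ≤ 1 ∧ (nb G u').card ≤ 1) ∨
    (∃ u ∈ Y, ∃ u' ∈ Y, u ≠ u' ∧ (nb G u).card ≤ 1 ∧ (nb G u').card ≤ 1) ∨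
    (∃ u ∈ X, ∃ v ∈ Y, (∀ y, G.Adj u y → y = v) ∧ (∀ x, G.Adj v x → x = u)) := by
  obtain ⟨H, hGH, hmax⟩ := Finite.exists_le_maximal
    (p := fun H : SimpleGraph V => Bip H X Y n ∧ ¬ HP H) (a := G) ⟨hB, hnt⟩
  have hm : ∀ v, (nb G v).card ≤ (nb H v).card := fun v => Finset.card_le_card (nb_mono hGH v)
  have hcl : ∀ x ∈ X, ∀ y ∈ Y, ¬ H.Adj x y → (nb H x).card + (nb H y).card ≤ n := by
    intro x hx y hy hxy
    apply cross hmax.prop.1 hx hy hmax.prop.2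
    by_contra hcon
    have hB' : Bip (H ⊔ SimpleGraph.edge x y) X Y n := by
      refine ⟨hB.disj, hB.cov, hB.cX, hB.cY, ?_⟩
      intro a b hab
      rw [SimpleGraph.sup_adj, SimpleGraph.edge_adj] at hab
      rcases hab with h | ⟨⟨rfl, rfl⟩ | ⟨rfl, rfl⟩, _⟩
      · exact hmax.prop.1.adj a b h
      · exact Or.inl ⟨hx, hy⟩
      · exact Or.inr ⟨hy, hx⟩
    have := hmax.le_of_ge ⟨hB', hcon⟩ le_sup_left
    apply hxy
    apply this
    rw [SimpleGraph.sup_adj, SimpleGraph.edge_adj]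
    right
    refine ⟨Or.inl ⟨rfl, rfl⟩, ?_⟩
    rintro rfl
    exact hB.disj _ hx hy
  have hs : ∑ x ∈ X, (nb G x).card ≤ ∑ x ∈ X, (nb H x).card := Finset.sum_le_sum (fun x _ => hm x)
  rcases closed_case hmax.prop.1 hn (by omega) hcl (fun v => (hδ v).trans (hm v)) hmax.prop.2 with
    ⟨u, hu, u', hu', a, b, c⟩ | ⟨u, hu, u', hu', a, b, c⟩ | ⟨u, hu, v, hv, a, b⟩
  · exact Or.inl ⟨u, hu, u', hu', a, (hm _).trans b, (hm _).trans c⟩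
  · exact Or.inr (Or.inl ⟨u, hu, u', hu', a, (hm _).trans b, (hm _).trans c⟩)
  · exact Or.inr (Or.inr ⟨u, hu, v, hv, fun y h => a y (hGH h), fun x h => b x (hGH h)⟩)

end

lemma spec_iff {V : Type*} [Fintype V] [DecidableEq V] (G : SimpleGraph V) (μ : ℝ) :
    μ ∈ spectrum ℝ (G.adjMatrix ℝ) ↔
      ∃ z : V → ℝ, z ≠ 0 ∧ ∀ v, ∑ w ∈ nb G v, z w = μ * z v := by
  rw [← Matrix.spectrum_toLin', ← Module.End.hasEigenvalue_iff_mem_spectrum]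
  have key : ∀ z : V → ℝ, (Matrix.toLin' (G.adjMatrix ℝ) z = μ • z ↔
      ∀ v, ∑ w ∈ nb G v, z w = μ * z v) := by
    intro z
    rw [funext_iff]
    refine forall_congr' fun v => ?_
    rw [Matrix.toLin'_apply, SimpleGraph.adjMatrix_mulVec_apply, Pi.smul_apply, smul_eq_mul]
    have : G.neighborFinset v = nb G v := by
      ext w; rw [mem_nb, SimpleGraph.mem_neighborFinset]
    rw [this]
  constructor
  · intro h
    obtain ⟨z, hz⟩ := h.exists_hasEigenvector
    exact ⟨z, hz.2, (key z).1 hz.apply_eq_smul⟩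
  · rintro ⟨z, h0, hz⟩
    exact Module.End.hasEigenvalue_of_hasEigenvector
      (Module.End.hasEigenvector_iff.2 ⟨Module.End.mem_eigenspace_iff.2 ((key z).2 hz), h0⟩)

lemma specRad_mem {V : Type*} [Fintype V] [DecidableEq V] [Nonempty V] (G : SimpleGraph V) :
    specRad G ∈ spectrum ℝ (G.adjMatrix ℝ) := by
  have hH : (G.adjMatrix ℝ).IsHermitian := by
    rw [Matrix.IsHermitian, Matrix.conjTranspose_eq_transpose_of_trivial]
    exact SimpleGraph.isSymm_adjMatrix G
  refine Set.Nonempty.csSup_mem ⟨_, hH.eigenvalues_mem_spectrum_real (Classical.arbitrary V)⟩ ?_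
  rw [← Matrix.spectrum_toLin']
  exact Module.End.finite_spectrum _

section
variable {V : Type*} [Fintype V] {G : SimpleGraph V} {X Y : Finset V} {n : ℕ}

lemma cs_half (hB : Bip G X Y n) {z : V → ℝ} {μ : ℝ} (hz : ∀ v, ∑ w ∈ nb G v, z w = μ * z v)
    (X' : Finset V) (hX' : X' ⊆ X) (h0 : ∀ x ∈ X, x ∉ X' → z x = 0) :
    μ ^ 2 * ∑ x ∈ X, z x ^ 2 ≤ ((∑ x ∈ X', (nb G x).card : ℕ) : ℝ) * ∑ y ∈ Y, z y ^ 2 := by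
  have e : ∑ x ∈ X, z x ^ 2 = ∑ x ∈ X', z x ^ 2 := by
    symm
    apply Finset.sum_subset hX'
    intro x hx hx'
    rw [h0 x hx hx']; ring
  rw [e, Finset.mul_sum, Nat.cast_sum, Finset.sum_mul]
  apply Finset.sum_le_sum
  intro x hx
  rw [← mul_pow, ← hz x]
  refine (sq_sum_le_card_mul_sum_sq).trans ?_
  apply mul_le_mul_of_nonneg_left _ (Nat.cast_nonneg _)
  exact Finset.sum_le_sum_of_subset_of_nonneg (hB.nb_sub (hX' hx)) (fun _ _ _ => sq_nonneg _)

lemma cs_full (hB : Bip G X Y n) {z : V → ℝ} {μ : ℝ} (hz : ∀ v, ∑ w ∈ nb G v, z w = μ * z v)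
    (hz0 : z ≠ 0) (X' Y' : Finset V) (hX' : X' ⊆ X) (h0 : ∀ x ∈ X, x ∉ X' → z x = 0)
    (hY' : Y' ⊆ Y) (h0' : ∀ x ∈ Y, x ∉ Y' → z x = 0)
    (hs : ∑ x ∈ X', (nb G x).card = ∑ y ∈ Y', (nb G y).card) :
    μ ^ 2 ≤ ((∑ x ∈ X', (nb G x).card : ℕ) : ℝ) := by
  have a := cs_half hB hz X' hX' h0
  have b := cs_half hB.symm hz Y' hY' h0'
  rw [← hs] at b
  have hpos : 0 < ∑ x ∈ X, z x ^ 2 + ∑ y ∈ Y, z y ^ 2 := by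
    obtain ⟨v, hv⟩ := Function.ne_iff.1 hz0
    have hv' : 0 < z v ^ 2 := by
      have : z v ≠ 0 := hv
      positivity
    have p1 : 0 ≤ ∑ x ∈ X, z x ^ 2 := Finset.sum_nonneg (fun _ _ => sq_nonneg _)
    have p2 : 0 ≤ ∑ x ∈ Y, z x ^ 2 := Finset.sum_nonneg (fun _ _ => sq_nonneg _)
    rcases hB.cov v with h | h
    · have := Finset.single_le_sum (f := fun x => z x ^ 2) (fun _ _ => sq_nonneg _) h
      linarith
    · have := Finset.single_le_sum (f := fun x => z x ^ 2) (fun _ _ => sq_nonneg _) h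
      linarith
  refine le_of_mul_le_mul_right ?_ hpos
  linarith

lemma R_case (hB : Bip G X Y n) (hn : 9 ≤ n) {z : V → ℝ} {μ : ℝ}
    (hz : ∀ v, ∑ w ∈ nb G v, z w = μ * z v) (hz0 : z ≠ 0) (hμ : (n : ℝ) - 1 ≤ μ)
    (hδ : ∀ v, 1 ≤ (nb G v).card)
    {u v : V} (hu : u ∈ X) (hv : v ∈ Y) (h1 : ∀ y, G.Adj u y → y = v) (h2 : ∀ x, G.Adj v x → x = u)
    {x y : V} (hx : x ∈ X) (hy : y ∈ Y) : G.Adj x y ↔ (x = u ∧ y = v) ∨ (x ≠ u ∧ y ≠ v) := by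
  have hn' : (9 : ℝ) ≤ n := by exact_mod_cast hn
  have nu : nb G u = {v} := by
    obtain ⟨w, hw⟩ := Finset.card_pos.1 (hδ u)
    have := h1 w (mem_nb.1 hw)
    subst this
    ext y; rw [Finset.mem_singleton]
    exact ⟨fun h => h1 y (mem_nb.1 h), fun h => h ▸ hw⟩
  have nv : nb G v = {u} := by
    obtain ⟨w, hw⟩ := Finset.card_pos.1 (hδ v)
    have := h2 w (mem_nb.1 hw)
    subst this
    ext y; rw [Finset.mem_singleton]
    exact ⟨fun h => h2 y (mem_nb.1 h), fun h => h ▸ hw⟩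
  have huv : G.Adj u v := by rw [← mem_nb, nu]; simp
  have z1 := hz u
  have z2 := hz v
  rw [nu, Finset.sum_singleton] at z1
  rw [nv, Finset.sum_singleton] at z2
  have zu : z u = 0 := by
    have : (μ ^ 2 - 1) * z u = 0 := by rw [z1] at z2; linear_combination -z2
    rcases mul_eq_zero.1 this with h | h
    · nlinarith
    · exact h
  have zv : z v = 0 := by rw [z1, zu, mul_zero]
  have hs := sum_eq hB
  rw [← Finset.add_sum_erase X _ hu, ← Finset.add_sum_erase Y _ hv, nu, nv] at hs
  simp only [Finset.card_singleton] at hs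
  have hb := cs_full hB hz hz0 (X.erase u) (Y.erase v) (Finset.erase_subset _ _)
    (by intro x hx hx'; have : x = u := by simpa [hx] using hx'
        rw [this, zu])
    (Finset.erase_subset _ _)
    (by intro x hx hx'; have : x = v := by simpa [hx] using hx'
        rw [this, zv]) (by omega)
  have hb2 : (n - 1) * (n - 1) ≤ ∑ x ∈ X.erase u, (nb G x).card := by
    have : (((n - 1) * (n - 1) : ℕ) : ℝ) ≤ ((∑ x ∈ X.erase u, (nb G x).card : ℕ) : ℝ) := by
      push_cast [Nat.cast_sub (by omega : 1 ≤ n)]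
      push_cast at hb
      nlinarith
    exact_mod_cast this
  constructor
  · intro h
    by_cases e : x = u
    · subst e; exact Or.inl ⟨rfl, h1 y h⟩
    · refine Or.inr ⟨e, ?_⟩
      rintro rfl
      exact e (h2 x h.symm)
  · rintro (⟨rfl, rfl⟩ | ⟨hxu, hyv⟩)
    · exact huv
    · by_contra hna
      have hxe : x ∈ X.erase u := by simp [hx, hxu]
      rw [← Finset.add_sum_erase _ _ hxe] at hb2
      have b1 : ∑ x ∈ (X.erase u).erase x, (nb G x).card ≤ ((X.erase u).erase x).card • (n - 1) := by
        apply Finset.sum_le_card_nsmul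
        intro w hw
        simp only [Finset.mem_erase] at hw
        have := nb_lt hB hw.2.2 hv (fun k => hw.2.1 (h2 w k.symm))
        omega
      rw [smul_eq_mul, Finset.card_erase_of_mem hxe, Finset.card_erase_of_mem hu, hB.cX] at b1
      have b2 : (nb G x).card ≤ ((Y.erase v).erase y).card := by
        apply Finset.card_le_card
        intro w hw
        simp only [Finset.mem_erase]
        refine ⟨?_, ?_, hB.nb_sub hx hw⟩
        · rintro rfl; exact hna (mem_nb.1 hw)
        · rintro rfl; exact hxu (h2 x (mem_nb.1 hw).symm)
      rw [Finset.card_erase_of_mem (by simp [hy, hyv]), Finset.card_erase_of_mem hv, hB.cY] at b2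
      obtain ⟨c, rfl⟩ : ∃ c, n = c + 2 := ⟨n - 2, by omega⟩
      have e1 : c + 2 - 1 - 1 = c := by omega
      have e2 : c + 2 - 1 = c + 1 := by omega
      rw [e1] at b1 b2
      rw [e2] at b1 hb2
      nlinarith

lemma Q_case (hB : Bip G X Y n) (hn : 9 ≤ n) {z : V → ℝ} {μ : ℝ}
    (hz : ∀ v, ∑ w ∈ nb G v, z w = μ * z v) (hz0 : z ≠ 0) (hμ : (n : ℝ) - 1 ≤ μ)
    {u u' : V} (hu : u ∈ X) (hu' : u' ∈ X) (huu : u ≠ u')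
    (h1 : (nb G u).card ≤ 1) (h2 : (nb G u').card ≤ 1) : False := by
  have hn' : (9 : ℝ) ≤ n := by exact_mod_cast hn
  have hμ0 : 0 < μ := by linarith
  let f : V → ℝ := fun x => if x = u ∨ x = u' then 1 / 4 else 1
  have fpos : ∀ x, 0 < f x := by intro x; simp only [f]; split_ifs <;> norm_num
  have fu : f u = 1 / 4 := by simp [f]
  have fu' : f u' = 1 / 4 := by simp [f]
  have hu'e : u' ∈ X.erase u := by simp [hu', huu.symm]
  have fcore : ∀ x ∈ (X.erase u).erase u', f x = 1 := by
    intro x hx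
    simp only [Finset.mem_erase] at hx
    simp [f, hx.1, hx.2.1]
  have ccard : ((((X.erase u).erase u').card : ℕ) : ℝ) = n - 2 := by
    rw [Finset.card_erase_of_mem hu'e, Finset.card_erase_of_mem hu, hB.cX, Nat.sub_sub,
      Nat.cast_sub (by omega)]
    norm_num
  have sf : ∑ x ∈ X, f x = n - 3 / 2 := by
    rw [← Finset.add_sum_erase X _ hu, ← Finset.add_sum_erase _ _ hu'e, Finset.sum_congr rfl fcore,
      fu, fu', Finset.sum_const, nsmul_eq_mul, ccard]
    ring
  obtain ⟨x, hx, hmax⟩ := Finset.exists_max_image X (fun x => |z x| / f x) ⟨u, hu⟩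
  set m := |z x| / f x with hm
  have hle : ∀ w ∈ X, |z w| ≤ m * f w := by
    intro w hw
    have := hmax w hw
    rwa [div_le_iff₀ (fpos w)] at this
  have hzx : |z x| = m * f x := by rw [hm]; field_simp [(fpos x).ne']
  have hm0 : 0 ≤ m := div_nonneg (abs_nonneg _) (fpos x).le
  have hY : ∀ y ∈ Y, μ * |z y| ≤ m * ∑ w ∈ nb G y, f w := by
    intro y hy
    rw [← abs_of_pos hμ0, ← abs_mul, ← hz y, Finset.mul_sum]
    refine (Finset.abs_sum_le_sum_abs _ _).trans (Finset.sum_le_sum ?_)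
    intro w hw
    exact hle w (hB.symm.nb_sub hy hw)
  have hmpos : 0 < m := by
    rcases hm0.lt_or_eq with h | h
    · exact h
    · exfalso
      apply hz0
      have zX : ∀ w ∈ X, z w = 0 := by
        intro w hw
        have := hle w hw
        rw [← h, zero_mul] at this
        exact abs_nonpos_iff.1 this
      ext w
      rcases hB.cov w with hw | hw
      · exact zX w hw
      · have := hY w hw
        rw [← h, zero_mul] at this
        have h3 : |z w| ≤ 0 := by
          by_contra k
          push Not at k
          nlinarith
        exact abs_nonpos_iff.1 h3
  have main : μ ^ 2 * f x ≤ ∑ y ∈ nb G x, ∑ w ∈ nb G y, f w := by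
    have a : μ * |z x| ≤ ∑ y ∈ nb G x, |z y| := by
      rw [← abs_of_pos hμ0, ← abs_mul, ← hz x]
      exact Finset.abs_sum_le_sum_abs _ _
    have b : μ * ∑ y ∈ nb G x, |z y| ≤ m * ∑ y ∈ nb G x, ∑ w ∈ nb G y, f w := by
      rw [Finset.mul_sum, Finset.mul_sum]
      exact Finset.sum_le_sum (fun y hy => hY y (hB.nb_sub hx hy))
    have c : μ * (μ * |z x|) ≤ m * ∑ y ∈ nb G x, ∑ w ∈ nb G y, f w :=
      (mul_le_mul_of_nonneg_left a hμ0.le).trans b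
    rw [hzx] at c
    refine le_of_mul_le_mul_left ?_ hmpos
    linarith
  have hμ2 : (n : ℝ) ^ 2 - 2 * n + 1 ≤ μ ^ 2 := by nlinarith
  have small : ∀ {w : V}, w ∈ X → (nb G w).card ≤ 1 → f w = 1 / 4 →
      ∑ y ∈ nb G w, ∑ w ∈ nb G y, f w ≤ (n : ℝ) - 3 / 2 := by
    intro w hw hc _
    have : ∑ y ∈ nb G w, ∑ w ∈ nb G y, f w ≤ (nb G w).card • ((n : ℝ) - 3 / 2) := by
      apply Finset.sum_le_card_nsmul
      intro y hy
      rw [← sf]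
      exact Finset.sum_le_sum_of_subset_of_nonneg (hB.symm.nb_sub (hB.nb_sub hw hy))
        (fun _ _ _ => (fpos _).le)
    rw [nsmul_eq_mul] at this
    have hc' : ((nb G w).card : ℝ) ≤ 1 := by exact_mod_cast hc
    nlinarith
  by_cases hxu : x = u
  · subst hxu
    have := small hx h1 fu
    rw [fu] at main
    nlinarith
  by_cases hxu' : x = u'
  · subst hxu'
    have := small hx h2 fu'
    rw [fu'] at main
    nlinarith
  have fx : f x = 1 := fcore x (by simp [hx, hxu, hxu'])
  have big : ∑ y ∈ nb G x, ∑ w ∈ nb G y, f w ≤ ∑ w ∈ X, (nb G w).card * f w := by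
    calc ∑ y ∈ nb G x, ∑ w ∈ nb G y, f w ≤ ∑ y ∈ Y, ∑ w ∈ nb G y, f w :=
          Finset.sum_le_sum_of_subset_of_nonneg (hB.nb_sub hx)
            (fun _ _ _ => Finset.sum_nonneg (fun _ _ => (fpos _).le))
      _ = ∑ w ∈ X, ∑ y ∈ nb G w, f w := by
          apply Finset.sum_comm'
          intro y w
          simp only [mem_nb]
          constructor
          · rintro ⟨hy, h⟩
            exact ⟨h.symm, hB.symm.nb_sub hy (mem_nb.2 h)⟩
          · rintro ⟨h, hw⟩
            exact ⟨hB.nb_sub hw (mem_nb.2 h), h.symm⟩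
      _ = _ := by simp [Finset.sum_const, nsmul_eq_mul]
  have big2 : ∑ w ∈ X, (nb G w).card * f w ≤ 1 / 4 + (1 / 4 + ((n : ℝ) - 2) * n) := by
    rw [← Finset.add_sum_erase X _ hu, ← Finset.add_sum_erase _ _ hu'e, fu, fu']
    have h1' : ((nb G u).card : ℝ) ≤ 1 := by exact_mod_cast h1
    have h2' : ((nb G u').card : ℝ) ≤ 1 := by exact_mod_cast h2
    refine add_le_add (by linarith) (add_le_add (by linarith) ?_)
    rw [← ccard, ← nsmul_eq_mul]
    apply Finset.sum_le_card_nsmul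
    intro w hw
    rw [fcore w hw, mul_one]
    simp only [Finset.mem_erase] at hw
    exact_mod_cast nb_le hB hw.2.2
  rw [fx] at main
  nlinarith

lemma eig_le {z : V → ℝ} {μ c : ℝ} (hz : ∀ v, ∑ w ∈ nb G v, z w = μ * z v) (hz0 : z ≠ 0)
    (hc : ∀ v, ((nb G v).card : ℝ) ≤ c) : μ ≤ c := by
  obtain ⟨v0, hv0⟩ := Function.ne_iff.1 hz0
  obtain ⟨v, -, hmax⟩ := Finset.exists_max_image Finset.univ (fun x => |z x|) ⟨v0, Finset.mem_univ _⟩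
  have hpos : 0 < |z v| := lt_of_lt_of_le (abs_pos.2 hv0) (hmax v0 (Finset.mem_univ _))
  have a : μ * |z v| ≤ |μ * z v| := by
    rw [abs_mul]; exact mul_le_mul_of_nonneg_right (le_abs_self _) (abs_nonneg _)
  rw [← hz v] at a
  have b : ∑ w ∈ nb G v, |z w| ≤ (nb G v).card • |z v| :=
    Finset.sum_le_card_nsmul _ _ _ (fun w _ => hmax w (Finset.mem_univ _))
  rw [nsmul_eq_mul] at b
  have d := (a.trans (Finset.abs_sum_le_sum_abs _ _)).trans b
  exact (le_of_mul_le_mul_right d hpos).trans (hc v)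

end

lemma bip_of {n : ℕ} {G : SimpleGraph (Fin n ⊕ Fin n)} (h : CrossOnly G) :
    Bip G (Finset.univ.map Function.Embedding.inl) (Finset.univ.map Function.Embedding.inr) n := by
  refine ⟨?_, ?_, by simp, by simp, ?_⟩
  · rintro (v | v) <;> simp
  · rintro (v | v) <;> simp
  · rintro (a | a) (b | b) hab
    · exact (h.1 _ _ hab).elim
    · simp
    · simp
    · exact (h.2 _ _ hab).elim

lemma R_cross (n k : ℕ) : CrossOnly (Rgraph n k) := by
  constructor <;> intro x y h <;> simp [Rgraph] at h

lemma R_adj {n : ℕ} (x y : Fin n) : (Rgraph n 1).Adj (Sum.inl x) (Sum.inr y) ↔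
    (x.val = 0 ∧ y.val = 0) ∨ (x.val ≠ 0 ∧ y.val ≠ 0) := by
  simp [Rgraph]
  omega

lemma count_fin {n : ℕ} (hn : 9 ≤ n) : ∑ y : Fin n, (if y.val = 0 then (0 : ℝ) else 1) = n - 1 := by
  obtain ⟨m, rfl⟩ : ∃ m, n = m + 1 := ⟨n - 1, by omega⟩
  rw [Fin.sum_univ_succ]
  simp

lemma specR {n : ℕ} (hn : 9 ≤ n) : specRad (Rgraph n 1) = (n : ℝ) - 1 := by
  apply IsGreatest.csSup_eq
  constructor
  · rw [spec_iff]
    refine ⟨Sum.elim (fun x => if x.val = 0 then 0 else 1) (fun x => if x.val = 0 then 0 else 1), ?_, ?_⟩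
    · intro h
      have := congrFun h (Sum.inl ⟨1, by omega⟩)
      simp at this
    · have cf := count_fin hn
      have hcr := R_cross n 1
      rintro (x | x)
      · rw [nb, Finset.sum_filter, Fintype.sum_sum_type]
        simp only [hcr.1, R_adj, Sum.elim_inl, Sum.elim_inr, if_false, Finset.sum_const_zero, zero_add]
        by_cases hx : x.val = 0
        · simp [hx]
          apply Finset.sum_eq_zero
          intro i _
          by_cases hi : i.val = 0 <;> simp [hi]
        · simp only [hx, false_and, false_or, ne_eq, not_false_eq_true, true_and, if_false, mul_one]
          rw [← cf]
          apply Finset.sum_congr rfl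
          intro y _
          by_cases hy : y.val = 0 <;> simp [hy]
      · rw [nb, Finset.sum_filter, Fintype.sum_sum_type]
        simp only [hcr.2, SimpleGraph.adj_comm _ (Sum.inr x) (Sum.inl _), R_adj, Sum.elim_inl,
          Sum.elim_inr, if_false, Finset.sum_const_zero, add_zero]
        by_cases hx : x.val = 0
        · simp [hx]
          apply Finset.sum_eq_zero
          intro i _
          by_cases hi : i.val = 0 <;> simp [hi]
        · simp only [hx, and_false, false_or, ne_eq, not_false_eq_true, and_true, if_false, mul_one]
          rw [← cf]
          apply Finset.sum_congr rfl
          intro y _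
          by_cases hy : y.val = 0 <;> simp [hy]
  · intro μ hμ
    rw [spec_iff] at hμ
    obtain ⟨z, hz0, hz⟩ := hμ
    refine eig_le hz hz0 ?_
    have hB := bip_of (R_cross n 1)
    have hop : ∀ x : Fin n, ∃ y : Fin n, ¬ ((x.val = 0 ∧ y.val = 0) ∨ (x.val ≠ 0 ∧ y.val ≠ 0)) := by
      intro x
      by_cases hx : x.val = 0
      · exact ⟨⟨1, by omega⟩, by simp [hx]⟩
      · exact ⟨⟨0, by omega⟩, by simp [hx]⟩
    have key : ∀ v, (nb (Rgraph n 1) v).card + 1 ≤ n := by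
      rintro (x | x)
      · obtain ⟨y, hy⟩ := hop x
        exact nb_lt hB (y := Sum.inr y) (by simp) (by simp) (by rw [R_adj]; exact hy)
      · obtain ⟨y, hy⟩ := hop x
        exact nb_lt hB.symm (y := Sum.inl y) (by simp) (by simp)
          (by rw [SimpleGraph.adj_comm, R_adj]; tauto)
    intro v
    have : (((nb (Rgraph n 1) v).card + 1 : ℕ) : ℝ) ≤ n := by exact_mod_cast key v
    push_cast at this
    linarith

lemma iso_R {n : ℕ} (hn : 9 ≤ n) {G : SimpleGraph (Fin n ⊕ Fin n)} (hG : CrossOnly G) (u v : Fin n)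
    (h : ∀ x y, G.Adj (Sum.inl x) (Sum.inr y) ↔ (x = u ∧ y = v) ∨ (x ≠ u ∧ y ≠ v)) :
    Nonempty (G ≃g Rgraph n 1) := by
  have hR := R_cross n 1
  let o : Fin n := ⟨0, by omega⟩
  have hs : ∀ u x : Fin n, (Equiv.swap u o x).val = 0 ↔ x = u := by
    intro u x
    have : (Equiv.swap u o x).val = 0 ↔ Equiv.swap u o x = o := by rw [Fin.ext_iff]
    rw [this, Equiv.swap_apply_eq_iff, Equiv.swap_apply_right]
  refine ⟨⟨Equiv.sumCongr (Equiv.swap u o) (Equiv.swap v o), ?_⟩⟩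
  rintro (a | a) (b | b)
  · simp [hR.1, hG.1]
  · simp only [Equiv.sumCongr_apply, Sum.map_inl, Sum.map_inr, R_adj, h, hs, ne_eq]
  · simp only [Equiv.sumCongr_apply, Sum.map_inl, Sum.map_inr]
    rw [SimpleGraph.adj_comm, R_adj, SimpleGraph.adj_comm, h]
    simp only [hs, ne_eq]
  · simp [hR.2, hG.2]

/-- A balanced bipartite graph on `2n` vertices with `δ(G) ≥ 1`, `n ≥ 9` and
`ρ(G) ≥ ρ(R_n^1) = n - 1` is traceable unless `G = R_n^1`. -/
theorem stmt_15 (n : ℕ) (G : SimpleGraph (Fin n ⊕ Fin n)) (hbip : CrossOnly G)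
    (hn : 9 ≤ n) (hdeg : ∀ v, 1 ≤ G.degree v)
    (hρ : specRad (Rgraph n 1) ≤ specRad G) :
    specRad (Rgraph n 1) = (n : ℝ) - 1 ∧
    (G.IsTraceable ∨ Nonempty (G ≃g Rgraph n 1)) := by
  refine ⟨specR hn, ?_⟩
  rw [specR hn] at hρ
  have : Nonempty (Fin n ⊕ Fin n) := ⟨Sum.inl ⟨0, by omega⟩⟩
  by_cases hHP : HP G
  · exact Or.inl hHP.traceable
  right
  have hB := bip_of hbip
  have hδ : ∀ v, 1 ≤ (nb G v).card := by
    intro v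
    have h := hdeg v
    rw [← SimpleGraph.card_neighborFinset_eq_degree] at h
    have e : G.neighborFinset v = nb G v := by
      ext w; rw [mem_nb, SimpleGraph.mem_neighborFinset]
    rwa [e] at h
  obtain ⟨z, hz0, hz⟩ := (spec_iff G _).1 (specRad_mem G)
  have hn' : (9 : ℝ) ≤ n := by exact_mod_cast hn
  have he := cs_full hB hz hz0 _ _ (Finset.Subset.refl _) (fun x h k => absurd h k)
    (Finset.Subset.refl _) (fun x h k => absurd h k) (sum_eq hB)
  have he' : n ^ 2 + 1 ≤ ∑ x ∈ Finset.univ.map Function.Embedding.inl, (nb G x).card + 2 * n := by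
    have h2 : (n : ℝ) ^ 2 + 1 ≤ ((∑ x ∈ Finset.univ.map Function.Embedding.inl,
        (nb G x).card : ℕ) : ℝ) + 2 * n := by nlinarith
    exact_mod_cast h2
  rcases comb hB hn he' hδ hHP with
    ⟨u, hu, u', hu', a, b, c⟩ | ⟨u, hu, u', hu', a, b, c⟩ | ⟨u, hu, v, hv, a, b⟩
  · exact (Q_case hB hn hz hz0 hρ hu hu' a b c).elim
  · exact (Q_case hB.symm hn hz hz0 hρ hu hu' a b c).elim
  · have key := fun x y => R_case hB hn hz hz0 hρ hδ hu hv a b (x := Sum.inl x) (y := Sum.inr y)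
      (by simp) (by simp)
    rw [Finset.mem_map] at hu hv
    obtain ⟨u, -, rfl⟩ := hu
    obtain ⟨v, -, rfl⟩ := hv
    refine iso_R hn hbip u v ?_
    intro x y
    rw [key x y]
    simp
end
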